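/- arXiv:1112.1818 — 3 statements merged into one kernel-verified Lean document; each statement's English description precedes it below -/
import Mathlib

section
/- (No-neck oscillation estimate, from the proof of Proposition 2.6) For every dimension n ≥ 1 there exist constants ε₂ > 0 and C > 0 with the following property: let T ≥ 3 and let f : ℝ² → ℝⁿ be smooth, 2π-periodic in θ, weakly conformal, with Δf = 0 at every point where ∇f = 0. If sup_{s ∈ [−T, T−1]} W(f, [s,s+1]×[0,2π]) < ε₂², then for all points (t₁,θ₁), (t₂,θ₂) ∈ ℝ² with t₁, t₂ ∈ [−T+2, T−2], one has |f(t₁,θ₁) − f(t₂,θ₂)| ≤ C (∫_{[−T,T]×[0,2π]} |∇f|²)^{1/2}. -/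
open MeasureTheory Set Filter
open scoped ENNReal Real RealInnerProductSpace

/-- Partial derivative in the first coordinate direction. -/
noncomputable def pd1 {n : ℕ} (f : ℝ × ℝ → EuclideanSpace ℝ (Fin n)) (z : ℝ × ℝ) :
    EuclideanSpace ℝ (Fin n) := fderiv ℝ f z (1, 0)

/-- Partial derivative in the second coordinate direction. -/
noncomputable def pd2 {n : ℕ} (f : ℝ × ℝ → EuclideanSpace ℝ (Fin n)) (z : ℝ × ℝ) :
    EuclideanSpace ℝ (Fin n) := fderiv ℝ f z (0, 1)

/-- `|∇f|²`. -/
noncomputable def gradSq {n : ℕ} (f : ℝ × ℝ → EuclideanSpace ℝ (Fin n)) (z : ℝ × ℝ) : ℝ :=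
    ‖pd1 f z‖ ^ 2 + ‖pd2 f z‖ ^ 2

/-- The Laplacian `Δf = ∂²f/∂x² + ∂²f/∂y²`. -/
noncomputable def lap {n : ℕ} (f : ℝ × ℝ → EuclideanSpace ℝ (Fin n)) (z : ℝ × ℝ) :
    EuclideanSpace ℝ (Fin n) := pd1 (pd1 f) z + pd2 (pd2 f) z

/-- The Willmore energy `W(f, Ω) = ∫_{Ω ∩ {∇f ≠ 0}} |Δf|²/|∇f|²`. -/
noncomputable def willmore {n : ℕ} (f : ℝ × ℝ → EuclideanSpace ℝ (Fin n))
    (Ω : Set (ℝ × ℝ)) : ℝ≥0∞ :=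
  ∫⁻ z in Ω ∩ {w | gradSq f w ≠ 0}, ENNReal.ofReal (‖lap f z‖ ^ 2 / gradSq f z)

/-- The unnormalized Fourier coefficient of a real function on `[0, 2π]`. -/
noncomputable def fourierCoef (k : ℤ) (h : ℝ → ℝ) : ℂ :=
  ∫ θ in (0 : ℝ)..2 * π, Complex.exp (-(k * θ : ℝ) * Complex.I) * h θ

lemma norm_exp_neg_mul_I (x : ℝ) : ‖Complex.exp (-(x : ℂ) * Complex.I)‖ = 1 := by
  have := Complex.norm_exp_ofReal_mul_I (-x)
  simpa using this

lemma norm_fourierCoef_le (k : ℤ) (h : ℝ → ℝ) :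
    ‖fourierCoef k h‖ ≤ ∫ θ in (0 : ℝ)..2 * π, |h θ| := by
  refine (intervalIntegral.norm_integral_le_integral_norm Real.two_pi_pos.le).trans_eq ?_
  refine intervalIntegral.integral_congr fun θ _ => ?_
  simp only [norm_mul, norm_exp_neg_mul_I, one_mul, Complex.norm_real, Real.norm_eq_abs]

lemma hasSum_sq_fourierCoef {h : ℝ → ℝ} (hh : Continuous h) :
    HasSum (fun k => ‖fourierCoef k h‖ ^ 2) (2 * π * ∫ θ in (0 : ℝ)..2 * π, h θ ^ 2) := by
  have hL : MemLp (fun θ => (h θ : ℂ)) 2 (volume.restrict (Ioc 0 (2 * π))) := by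
    obtain ⟨M, hM⟩ := (isCompact_Icc (a := (0 : ℝ)) (b := 2 * π)).exists_bound_of_continuousOn
      hh.continuousOn
    refine MemLp.of_bound (Continuous.aestronglyMeasurable (by fun_prop)) M ?_
    refine (ae_restrict_iff' measurableSet_Ioc).2 (Eventually.of_forall fun θ hθ => ?_)
    rw [Complex.norm_real]
    exact hM θ (Ioc_subset_Icc_self hθ)
  have key := (hasSum_sq_fourierCoeffOn Real.two_pi_pos hL).mul_left ((2 * π) ^ 2)
  have hpi : (2 * π : ℝ) ≠ 0 := Real.two_pi_pos.ne'
  have e1 : ∀ k : ℤ, fourierCoef k h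
      = (2 * π : ℝ) * fourierCoeffOn Real.two_pi_pos (fun θ => (h θ : ℂ)) k := by
    intro k
    rw [fourierCoeffOn_eq_integral, fourierCoef, sub_zero, Complex.real_smul, ← mul_assoc,
      ← Complex.ofReal_mul, mul_one_div_cancel hpi, Complex.ofReal_one, one_mul]
    refine intervalIntegral.integral_congr fun θ _ => ?_
    simp only [fourier_coe_apply, smul_eq_mul]
    congr 2
    have : (π : ℂ) ≠ 0 := by exact_mod_cast Real.pi_ne_zero
    push_cast
    field_simp
  have e2 : (2 * π) ^ 2 * ((2 * π - 0)⁻¹ • ∫ x in (0 : ℝ)..2 * π, ‖(h x : ℂ)‖ ^ 2)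
      = 2 * π * ∫ θ in (0 : ℝ)..2 * π, h θ ^ 2 := by
    simp only [Complex.norm_real, Real.norm_eq_abs, sq_abs, sub_zero, smul_eq_mul]
    field_simp
  rw [e2] at key
  have e3 : (fun k => ‖fourierCoef k h‖ ^ 2) = fun k : ℤ =>
      (2 * π) ^ 2 * ‖fourierCoeffOn Real.two_pi_pos (fun θ => (h θ : ℂ)) k‖ ^ 2 := by
    ext k
    rw [e1, norm_mul, mul_pow, Complex.norm_real, Real.norm_of_nonneg Real.two_pi_pos.le]
  rw [e3]
  exact key

lemma fourierCoef_add (k : ℤ) {h g : ℝ → ℝ} (hh : Continuous h) (hg : Continuous g) :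
    fourierCoef k (fun θ => h θ + g θ) = fourierCoef k h + fourierCoef k g := by
  unfold fourierCoef
  rw [← intervalIntegral.integral_add
    (Continuous.intervalIntegrable (by fun_prop) _ _)
    (Continuous.intervalIntegrable (by fun_prop) _ _)]
  refine intervalIntegral.integral_congr fun θ _ => ?_
  simp only [Complex.ofReal_add, mul_add]

lemma fourierCoef_deriv (k : ℤ) {h h' : ℝ → ℝ} (hd : ∀ θ, HasDerivAt h (h' θ) θ)
    (hc : Continuous h') (hp : h (2 * π) = h 0) :
    fourierCoef k h' = k * Complex.I * fourierCoef k h := by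
  have hexp : ∀ θ : ℝ, HasDerivAt (fun x : ℝ => Complex.exp (-(k * x : ℝ) * Complex.I))
      (-(k * Complex.I) * Complex.exp (-(k * θ : ℝ) * Complex.I)) θ := by
    intro θ
    have h1 : HasDerivAt (fun x : ℝ => -((k * x : ℝ) : ℂ) * Complex.I) (-(k * Complex.I)) θ := by
      have := (((Complex.ofRealCLM.hasDerivAt (x := θ)).const_mul (k : ℂ)).neg.mul_const Complex.I)
      simpa [Function.comp_def] using this
    simpa [mul_comm] using h1.cexp
  have hhc : Continuous h := continuous_iff_continuousAt.2 fun θ => (hd θ).continuousAt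
  have key := intervalIntegral.integral_mul_deriv_eq_deriv_mul (a := 0) (b := 2 * π)
    (fun θ _ => hexp θ) (fun θ _ => (hd θ).ofReal_comp)
    (Continuous.intervalIntegrable (by fun_prop) _ _)
    (Continuous.intervalIntegrable (by fun_prop) _ _)
  have e0 : Complex.exp (-((k * (2 * π) : ℝ) : ℂ) * Complex.I) = 1 := by
    rw [Complex.exp_eq_one_iff]
    exact ⟨-k, by push_cast; ring⟩
  rw [e0, hp] at key
  unfold fourierCoef
  rw [key, ← intervalIntegral.integral_const_mul]
  simp only [mul_zero, Complex.ofReal_zero, neg_zero, zero_mul, Complex.exp_zero, sub_self, zero_sub,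
    one_mul]
  rw [← intervalIntegral.integral_neg]
  refine intervalIntegral.integral_congr fun θ _ => ?_
  ring

lemma hasDerivAt_intervalIntegral_of_continuous {F F' : ℝ × ℝ → ℂ} (hF : Continuous F)
    (hF' : Continuous F') (hd : ∀ t θ, HasDerivAt (fun s => F (s, θ)) (F' (t, θ)) t)
    (a b t : ℝ) :
    HasDerivAt (fun s => ∫ θ in a..b, F (s, θ)) (∫ θ in a..b, F' (t, θ)) t := by
  obtain ⟨M, hM⟩ := ((isCompact_Icc (a := t - 1) (b := t + 1)).prod
    (isCompact_uIcc (a := a) (b := b))).exists_bound_of_continuousOn hF'.continuousOn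
  refine (intervalIntegral.hasDerivAt_integral_of_dominated_loc_of_deriv_le
    (F := fun s θ => F (s, θ)) (F' := fun s θ => F' (s, θ)) (bound := fun _ => M)
    (Icc_mem_nhds (show t - 1 < t by linarith) (show t < t + 1 by linarith))
    (Eventually.of_forall fun s => ?_) ?_ ?_ ?_ ?_ ?_).2
  · exact (Continuous.aestronglyMeasurable (by fun_prop))
  · exact (Continuous.intervalIntegrable (by fun_prop) _ _)
  · exact (Continuous.aestronglyMeasurable (by fun_prop))
  · exact Eventually.of_forall fun θ hθ s hs => hM (s, θ) ⟨hs, uIoc_subset_uIcc hθ⟩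
  · exact intervalIntegrable_const
  · exact Eventually.of_forall fun θ _ s _ => hd s θ

lemma hasDerivAt_fourierCoef (k : ℤ) {u u' : ℝ × ℝ → ℝ} (hu : Continuous u)
    (hu' : Continuous u') (hd : ∀ t θ, HasDerivAt (fun s => u (s, θ)) (u' (t, θ)) t) (t : ℝ) :
    HasDerivAt (fun s => fourierCoef k fun θ => u (s, θ)) (fourierCoef k fun θ => u' (t, θ)) t := by
  refine hasDerivAt_intervalIntegral_of_continuous
    (F := fun z => Complex.exp (-(k * z.2 : ℝ) * Complex.I) * u z)
    (F' := fun z => Complex.exp (-(k * z.2 : ℝ) * Complex.I) * u' z)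
    (by fun_prop) (by fun_prop) (fun t θ => ?_) _ _ _
  exact (hd t θ).ofReal_comp.const_mul (Complex.exp (-(k * θ : ℝ) * Complex.I))

/-- Norm bound from variation of constants for a first-order linear equation. -/
lemma norm_le_of_hasDerivAt_linear {p g : ℝ → ℂ} {G : ℝ → ℝ} {κ : ℝ}
    (hp : ∀ s, HasDerivAt p (κ * p s + g s) s) (hg : Continuous g) (hG : Continuous G)
    (hgG : ∀ s, ‖g s‖ ≤ G s) (b t : ℝ) :
    ‖p t‖ ≤ Real.exp (κ * (t - b)) * ‖p b‖ + |∫ s in b..t, Real.exp (κ * (t - s)) * G s| := by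
  have hd : ∀ s, HasDerivAt (fun s : ℝ => (Real.exp (κ * (t - s)) : ℂ) * p s)
      ((Real.exp (κ * (t - s)) : ℂ) * g s) s := by
    intro s
    have h1 : HasDerivAt (fun s : ℝ => Real.exp (κ * (t - s)))
        (Real.exp (κ * (t - s)) * (κ * (-1))) s :=
      (((hasDerivAt_id s).const_sub t).const_mul κ).exp
    have h2 := h1.ofReal_comp.mul (hp s)
    refine h2.congr_deriv ?_
    push_cast
    ring
  have hI := intervalIntegral.integral_eq_sub_of_hasDerivAt (a := b) (b := t)
    (fun s _ => hd s) (Continuous.intervalIntegrable (by fun_prop) _ _)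
  have e : p t = (Real.exp (κ * (t - b)) : ℂ) * p b
      + ∫ s in b..t, (Real.exp (κ * (t - s)) : ℂ) * g s := by
    rw [hI]; simp
  rw [e]
  refine (norm_add_le _ _).trans (add_le_add ?_ ?_)
  · rw [norm_mul, Complex.norm_real, Real.norm_of_nonneg (Real.exp_pos _).le]
  · refine intervalIntegral.norm_integral_le_abs_of_norm_le (Eventually.of_forall fun s => ?_)
      (Continuous.intervalIntegrable (by fun_prop) _ _)
    rw [norm_mul, Complex.norm_real, Real.norm_of_nonneg (Real.exp_pos _).le]
    exact mul_le_mul_of_nonneg_left (hgG s) (Real.exp_pos _).le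

lemma sum_sqrt_div_sqrt_mul_exp_le {x : ℝ} (hx : 0 < x) (N : ℕ) :
    ∑ i ∈ Finset.range N, √x / √((i : ℝ) + 1) * Real.exp (-(((i : ℝ) + 1) * x)) ≤ 4 := by
  suffices h : ∑ i ∈ Finset.range N, √x / √((i : ℝ) + 1) * Real.exp (-(((i : ℝ) + 1) * x))
      ≤ 4 * (√(N * x) / (1 + √(N * x))) by
    have h1 : √(N * x) / (1 + √(N * x)) ≤ 1 := by
      rw [div_le_one (by positivity)]; linarith
    linarith
  induction N with
  | zero => simp
  | succ N ih =>
    rw [Finset.sum_range_succ]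
    have key : √x / √((N : ℝ) + 1) * Real.exp (-(((N : ℝ) + 1) * x))
        ≤ 4 * (√(((N : ℝ) + 1) * x) / (1 + √(((N : ℝ) + 1) * x)) - √(N * x) / (1 + √(N * x))) := by
      have hy2 : √(((N : ℝ) + 1) * x) ^ 2 = ((N : ℝ) + 1) * x := Real.sq_sqrt (by positivity)
      have hz2 : √((N : ℝ) * x) ^ 2 = (N : ℝ) * x := Real.sq_sqrt (by positivity)
      have hy : 0 < √(((N : ℝ) + 1) * x) := Real.sqrt_pos.2 (by positivity)
      have hz : 0 ≤ √((N : ℝ) * x) := Real.sqrt_nonneg _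
      have hzy : √((N : ℝ) * x) ≤ √(((N : ℝ) + 1) * x) := Real.sqrt_le_sqrt (by nlinarith)
      have e1 : √x / √((N : ℝ) + 1) = x / √(((N : ℝ) + 1) * x) := by
        rw [Real.sqrt_mul (by positivity)]
        have h1 : 0 < √x := Real.sqrt_pos.2 hx
        have h2 : 0 < √((N : ℝ) + 1) := Real.sqrt_pos.2 (by positivity)
        rw [div_eq_div_iff h2.ne' (by positivity)]
        nlinarith [Real.sq_sqrt hx.le]
      have e2 : Real.exp (-(((N : ℝ) + 1) * x)) ≤ 1 / (1 + √(((N : ℝ) + 1) * x) ^ 2) := by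
        rw [hy2]
        rw [Real.exp_neg, ← one_div]
        refine one_div_le_one_div_of_le (by positivity) ?_
        linarith [Real.add_one_le_exp (((N : ℝ) + 1) * x)]
      rw [e1]
      refine (mul_le_mul_of_nonneg_left e2 (by positivity)).trans ?_
      have hx' : x = √(((N : ℝ) + 1) * x) ^ 2 - √((N : ℝ) * x) ^ 2 := by rw [hy2, hz2]; ring
      generalize √(((N : ℝ) + 1) * x) = y at *
      generalize √((N : ℝ) * x) = z at *
      have h1 : x / y ≤ 2 * (y - z) := by
        rw [div_le_iff₀ hy, hx']; nlinarith
      refine (mul_le_mul_of_nonneg_right h1 (by positivity)).trans ?_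
      have h2 : y / (1 + y) - z / (1 + z) = (y - z) / ((1 + y) * (1 + z)) := by
        field_simp; ring
      rw [h2, mul_one_div, ← mul_div_assoc, div_le_div_iff₀ (by positivity) (by positivity)]
      have h3 : (1 + y) * (1 + z) ≤ 2 * (1 + y ^ 2) := by nlinarith [sq_nonneg (1 - y)]
      nlinarith [mul_le_mul_of_nonneg_left h3 (sub_nonneg.2 hzy)]
    push_cast
    linarith

lemma intervalIntegrable_exp_div_sqrt (c : ℝ) {L : ℝ} (hL : 0 ≤ L) :
    IntervalIntegrable (fun x => Real.exp (-(c * x)) * (√x)⁻¹) volume 0 L := by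
  have h : IntervalIntegrable (fun x : ℝ => (√x)⁻¹) volume 0 L := by
    refine (intervalIntegral.intervalIntegrable_rpow' (r := -(1 / 2)) (by norm_num)
      (a := 0) (b := L)).congr ?_
    intro x hx
    rw [uIoc_of_le hL] at hx
    simp only
    rw [Real.rpow_neg hx.1.le, Real.sqrt_eq_rpow]
  exact h.continuousOn_mul (Continuous.continuousOn (by fun_prop))

lemma integral_exp_div_sqrt_le {c L : ℝ} (hc : 0 < c) (hL : 0 ≤ L) :
    ∫ x in (0 : ℝ)..L, Real.exp (-(c * x)) * (√x)⁻¹ ≤ 2 / √c := by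
  have hG := Real.integral_rpow_mul_exp_neg_mul_Ioi (a := 1 / 2) (by norm_num) hc
  have hval : (1 / c) ^ (1 / 2 : ℝ) * Real.Gamma (1 / 2) ≤ 2 / √c := by
    rw [Real.Gamma_one_half_eq, ← Real.sqrt_eq_rpow, Real.sqrt_div zero_le_one, Real.sqrt_one,
      one_div, ← div_eq_inv_mul]
    gcongr
    rw [Real.sqrt_le_left (by norm_num)]
    linarith [Real.pi_le_four]
  refine le_trans ?_ (hG.trans_le hval)
  rw [intervalIntegral.integral_of_le hL]
  have e : ∀ x ∈ Ioi (0 : ℝ), x ^ ((1 / 2 : ℝ) - 1) * Real.exp (-(c * x))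
      = Real.exp (-(c * x)) * (√x)⁻¹ := by
    intro x hx
    rw [mul_comm, Real.sqrt_eq_rpow, ← Real.rpow_neg (le_of_lt hx)]
    norm_num
  rw [setIntegral_congr_fun measurableSet_Ioi e]
  refine setIntegral_mono_set ?_ ?_ Ioc_subset_Ioi_self.eventuallyLE
  · refine IntegrableOn.congr_fun ?_ e measurableSet_Ioi
    refine Integrable.of_integral_ne_zero ?_
    rw [hG]
    have : 0 < Real.Gamma (1 / 2) := Real.Gamma_pos_of_pos (by norm_num)
    positivity
  · exact Eventually.of_forall fun x => by positivity

lemma sq_integral_exp_mul_le {H : ℝ → ℝ} (hH : Continuous H) (hH0 : ∀ x, 0 ≤ H x)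
    {k L : ℝ} (hk : 1 ≤ k) (hL : 0 ≤ L) :
    (∫ x in (0 : ℝ)..L, Real.exp (-(k * x)) * H x) ^ 2 ≤
      ∫ x in (0 : ℝ)..L,
        4 * (√(x / 2) / √k * Real.exp (-(k * (x / 2)))) * (Real.exp (-x) * H x ^ 2) := by
  set I := ∫ x in (0 : ℝ)..L, Real.exp (-(k * x)) * H x with hI
  set Q := ∫ x in (0 : ℝ)..L, Real.exp (-(k / 2 * x)) * √x * (Real.exp (-x) * H x ^ 2) with hQ
  have hA : ∀ l : ℝ, 0 < l → 2 * I ≤ l * (2 / √(k / 2)) + l⁻¹ * Q := by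
    intro l hl
    have h1 : 2 * I ≤ l * (∫ x in (0 : ℝ)..L, Real.exp (-(k / 2 * x)) * (√x)⁻¹) + l⁻¹ * Q := by
      rw [hI, hQ, ← intervalIntegral.integral_const_mul, ← intervalIntegral.integral_const_mul,
        ← intervalIntegral.integral_const_mul, ← intervalIntegral.integral_add
          ((intervalIntegrable_exp_div_sqrt _ hL).const_mul l)
          (Continuous.intervalIntegrable (by fun_prop) _ _)]
      refine intervalIntegral.integral_mono_on_of_le_Ioo hL
        (Continuous.intervalIntegrable (by fun_prop) _ _)
        (((intervalIntegrable_exp_div_sqrt _ hL).const_mul l).add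
          (Continuous.intervalIntegrable (by fun_prop) _ _)) fun x hx => ?_
      have hx0 : 0 < x := hx.1
      have hs : 0 < √x := Real.sqrt_pos.2 hx0
      have e1 : Real.exp (-(k * x)) = Real.exp (-(k / 2 * x)) * Real.exp (-(k / 2 * x)) := by
        rw [← Real.exp_add]; ring_nf
      have e2 : Real.exp (-(k / 2 * x)) ^ 2 ≤ Real.exp (-x) := by
        rw [← Real.exp_nat_mul]
        refine Real.exp_le_exp.2 ?_
        push_cast
        nlinarith
      have e3 : Real.exp (-(k / 2 * x)) ^ 2 * H x ^ 2 ≤ Real.exp (-x) * H x ^ 2 :=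
        mul_le_mul_of_nonneg_right e2 (sq_nonneg _)
      have e4 : 2 * (Real.exp (-(k / 2 * x)) * H x)
          ≤ l * (√x)⁻¹ + l⁻¹ * √x * (Real.exp (-x) * H x ^ 2) := by
        have h5 : l⁻¹ * √x * (Real.exp (-(k / 2 * x)) ^ 2 * H x ^ 2)
            ≤ l⁻¹ * √x * (Real.exp (-x) * H x ^ 2) := by gcongr
        have h6 : l * (√x)⁻¹ + l⁻¹ * √x * (Real.exp (-(k / 2 * x)) ^ 2 * H x ^ 2)
            - 2 * (Real.exp (-(k / 2 * x)) * H x)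
            = l⁻¹ * √x * (l * (√x)⁻¹ - Real.exp (-(k / 2 * x)) * H x) ^ 2 := by
          field_simp
          ring
        have h7 : 0 ≤ l⁻¹ * √x * (l * (√x)⁻¹ - Real.exp (-(k / 2 * x)) * H x) ^ 2 := by positivity
        linarith
      have := mul_le_mul_of_nonneg_left e4 (Real.exp_pos (-(k / 2 * x))).le
      rw [e1]
      nlinarith [this]
    have h2 := mul_le_mul_of_nonneg_left
      (integral_exp_div_sqrt_le (c := k / 2) (L := L) (by linarith) hL) hl.le
    linarith
  have hB : 0 < 2 / √(k / 2) := by positivity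
  have hQ0 : 0 ≤ Q := intervalIntegral.integral_nonneg hL fun x _ => by positivity
  have hI0 : 0 ≤ I := intervalIntegral.integral_nonneg hL fun x _ =>
    mul_nonneg (Real.exp_pos _).le (hH0 x)
  have hfin : I ^ 2 ≤ 2 / √(k / 2) * Q := by
    rcases hI0.eq_or_lt with hI0 | hI0
    · rw [← hI0, zero_pow two_ne_zero]
      positivity
    · have h1 := hA (I / (2 / √(k / 2))) (by positivity)
      rw [div_mul_cancel₀ _ hB.ne', inv_div] at h1
      have h2 : I ≤ (2 / √(k / 2)) / I * Q := by linarith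
      calc I ^ 2 = I * I := sq I
        _ ≤ I * ((2 / √(k / 2)) / I * Q) := mul_le_mul_of_nonneg_left h2 hI0.le
        _ = 2 / √(k / 2) * Q := by field_simp
  refine hfin.trans_eq ?_
  rw [hQ, ← intervalIntegral.integral_const_mul]
  refine intervalIntegral.integral_congr fun x hx => ?_
  rw [uIcc_of_le hL] at hx
  have e5 : Real.exp (-(k / 2 * x)) = Real.exp (-(k * (x / 2))) := by ring_nf
  rw [e5, Real.sqrt_div hx.1, Real.sqrt_div (by linarith : (0 : ℝ) ≤ k)]
  have hs2 : √(2 : ℝ) ^ 2 = 2 := Real.sq_sqrt (by norm_num)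
  have hk0 : 0 < √k := Real.sqrt_pos.2 (by linarith)
  field_simp
  rw [hs2]
  ring

/-- A discrete Hilbert-type inequality for the Laplace transform. -/
lemma sum_sq_integral_exp_mul_le {H : ℝ → ℝ} (hH : Continuous H) (hH0 : ∀ x, 0 ≤ H x)
    {L : ℝ} (hL : 0 ≤ L) (N : ℕ) :
    ∑ i ∈ Finset.range N, (∫ x in (0 : ℝ)..L, Real.exp (-(((i : ℝ) + 1) * x)) * H x) ^ 2
      ≤ 16 * ∫ x in (0 : ℝ)..L, Real.exp (-x) * H x ^ 2 := by
  have hint : ∀ i ∈ Finset.range N, IntervalIntegrable (fun x : ℝ =>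
      4 * (√(x / 2) / √((i : ℝ) + 1) * Real.exp (-(((i : ℝ) + 1) * (x / 2))))
        * (Real.exp (-x) * H x ^ 2)) volume 0 L := fun i _ =>
    Continuous.intervalIntegrable (by fun_prop) _ _
  refine (Finset.sum_le_sum fun (i : ℕ) _ => sq_integral_exp_mul_le hH hH0
    (show (1 : ℝ) ≤ (i : ℝ) + 1 by simp) hL).trans ?_
  rw [← intervalIntegral.integral_finsetSum hint, ← intervalIntegral.integral_const_mul]
  refine intervalIntegral.integral_mono_on_of_le_Ioo hL
    (Continuous.intervalIntegrable (by fun_prop) _ _)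
    (Continuous.intervalIntegrable (by fun_prop) _ _) fun x hx => ?_
  rw [← Finset.sum_mul, ← Finset.mul_sum]
  have := sum_sqrt_div_sqrt_mul_exp_le (x := x / 2) (by linarith [hx.1]) N
  exact mul_le_mul_of_nonneg_right (by linarith) (by positivity)

lemma sum_natAbs_sub_one_le {F : ℕ → ℝ} (hF : ∀ i, 0 ≤ F i) {R : ℝ}
    (hR : ∀ N, ∑ i ∈ Finset.range N, F i ≤ R) (s : Finset ℤ) (hs : (0 : ℤ) ∉ s) :
    ∑ k ∈ s, F (k.natAbs - 1) ≤ 2 * R := by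
  have key : ∀ s' : Finset ℤ, Set.InjOn (fun k : ℤ => k.natAbs - 1) (s' : Set ℤ) →
      ∑ k ∈ s', F (k.natAbs - 1) ≤ R := by
    intro s' hinj
    rw [← Finset.sum_image (f := F) (g := fun k : ℤ => k.natAbs - 1) hinj]
    refine le_trans ?_ (hR ((s'.image fun k : ℤ => k.natAbs - 1).sup id + 1))
    refine Finset.sum_le_sum_of_subset_of_nonneg (fun m hm => ?_) fun i _ _ => hF i
    exact Finset.mem_range.2 (Nat.lt_succ_of_le (Finset.le_sup (f := id) hm))
  rw [← Finset.sum_filter_add_sum_filter_not s (fun k => 0 < k), two_mul]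
  refine add_le_add (key _ ?_) (key _ ?_)
  · intro x hx y hy hxy
    simp only [Finset.coe_filter, Set.mem_ofPred_eq] at hx hy hxy
    omega
  · intro x hx y hy hxy
    simp only [Finset.coe_filter, Set.mem_ofPred_eq] at hx hy hxy
    have hx0 : x ≠ 0 := fun h => hs (h ▸ hx.1)
    have hy0 : y ≠ 0 := fun h => hs (h ▸ hy.1)
    omega

lemma continuous_slice_integral {E : Type*} [NormedAddCommGroup E] [NormedSpace ℝ E]
    {F : ℝ × ℝ → E} (hF : Continuous F) (a b : ℝ) :
    Continuous fun t => ∫ θ in a..b, F (t, θ) :=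
  intervalIntegral.continuous_parametric_intervalIntegral_of_continuous'
    (f := fun t θ => F (t, θ)) (by simpa [Function.uncurry_def] using hF) a b

section SliceEstimate

variable {u u₁ u₂ u₁₁ u₂₂ : ℝ × ℝ → ℝ}

lemma sq_norm_fourierCoef_le (hu : Continuous u) (hu₁ : Continuous u₁) (hu₂ : Continuous u₂)
    (hu₁₁ : Continuous u₁₁) (hu₂₂ : Continuous u₂₂)
    (h₁ : ∀ t θ, HasDerivAt (fun s => u (s, θ)) (u₁ (t, θ)) t)
    (h₁₁ : ∀ t θ, HasDerivAt (fun s => u₁ (s, θ)) (u₁₁ (t, θ)) t)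
    (h₂ : ∀ t θ, HasDerivAt (fun x => u (t, x)) (u₂ (t, θ)) θ)
    (h₂₂ : ∀ t θ, HasDerivAt (fun x => u₂ (t, x)) (u₂₂ (t, θ)) θ)
    (hp : ∀ t, u (t, 2 * π) = u (t, 0)) (hp₂ : ∀ t, u₂ (t, 2 * π) = u₂ (t, 0))
    {a b t : ℝ} (hat : a ≤ t) (htb : t ≤ b) {k : ℤ} (hk : k ≠ 0) {G : ℝ → ℝ} (hGc : Continuous G)
    (hG : ∀ t, ∫ θ in (0 : ℝ)..2 * π, |u₁₁ (t, θ) + u₂₂ (t, θ)| ≤ G t) :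
    ‖fourierCoef k fun θ => u₂ (t, θ)‖ ^ 2 ≤
      2 * Real.exp (-(b - t)) * (‖fourierCoef k fun θ => u₁ (b, θ)‖ ^ 2
        + ‖fourierCoef k fun θ => u₂ (b, θ)‖ ^ 2)
      + 2 * Real.exp (-(t - a)) * (‖fourierCoef k fun θ => u₁ (a, θ)‖ ^ 2
        + ‖fourierCoef k fun θ => u₂ (a, θ)‖ ^ 2)
      + (∫ x in (0 : ℝ)..(b - t), Real.exp (-((((k.natAbs - 1 : ℕ) : ℝ) + 1) * x)) * G (t + x)) ^ 2
      + (∫ x in (0 : ℝ)..(t - a),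
          Real.exp (-((((k.natAbs - 1 : ℕ) : ℝ) + 1) * x)) * G (t - x)) ^ 2 := by
  have hκ : (((k.natAbs - 1 : ℕ) : ℝ) + 1) = |(k : ℝ)| := by
    have h1 : 1 ≤ k.natAbs := Int.natAbs_pos.2 hk
    rw [← Nat.cast_add_one, Nat.sub_add_cancel h1, Nat.cast_natAbs, Int.cast_abs]
  have hκ1 : 1 ≤ |(k : ℝ)| := by
    rw [← hκ]; simp
  rw [hκ]
  have hκ2 : ((|(k : ℝ)| : ℝ) : ℂ) ^ 2 = (k : ℂ) ^ 2 := by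
    exact_mod_cast congrArg (fun x : ℝ => (x : ℂ)) (sq_abs (k : ℝ))
  set κ := |(k : ℝ)| with hκdef
  set c : ℝ → ℂ := fun s => fourierCoef k fun θ => u (s, θ) with hc
  set c₁ : ℝ → ℂ := fun s => fourierCoef k fun θ => u₁ (s, θ) with hc₁
  set g : ℝ → ℂ := fun s => fourierCoef k fun θ => u₁₁ (s, θ) + u₂₂ (s, θ) with hg
  have hc2 : ∀ s, ‖fourierCoef k fun θ => u₂ (s, θ)‖ = κ * ‖c s‖ := by
    intro s
    rw [fourierCoef_deriv k (h₂ s) (by fun_prop) (hp s), norm_mul, norm_mul, Complex.norm_I,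
      mul_one, Complex.norm_intCast]
  have hc22 : ∀ s, (fourierCoef k fun θ => u₂₂ (s, θ)) = -(κ : ℂ) ^ 2 * c s := by
    intro s
    rw [fourierCoef_deriv k (h₂₂ s) (by fun_prop) (hp₂ s),
      fourierCoef_deriv k (h₂ s) (by fun_prop) (hp s), hκ2]
    linear_combination (k : ℂ) ^ 2 * c s * Complex.I_sq
  have hd : ∀ s, HasDerivAt c (c₁ s) s := fun s => hasDerivAt_fourierCoef k hu hu₁ h₁ s
  have hd1 : ∀ s, HasDerivAt c₁ (g s + (κ : ℂ) ^ 2 * c s) s := by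
    intro s
    refine (hasDerivAt_fourierCoef k hu₁ hu₁₁ h₁₁ s).congr_deriv ?_
    rw [hg]
    simp only
    rw [fourierCoef_add k (by fun_prop) (by fun_prop), hc22]
    ring
  have hgc : Continuous g := by
    refine continuous_slice_integral
      (F := fun z => Complex.exp (-(k * z.2 : ℝ) * Complex.I) * (u₁₁ z + u₂₂ z : ℝ)) ?_ _ _
    fun_prop
  have hgG : ∀ s, ‖g s‖ ≤ G s := fun s => (norm_fourierCoef_le k _).trans (hG s)
  have hP := norm_le_of_hasDerivAt_linear (κ := κ) (p := fun s => c₁ s + κ * c s) (g := g)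
    (fun s => ((hd1 s).add ((hd s).const_mul (κ : ℂ))).congr_deriv (by ring)) hgc hGc hgG b t
  have hQ := norm_le_of_hasDerivAt_linear (κ := -κ) (p := fun s => c₁ s - κ * c s) (g := g)
    (fun s => ((hd1 s).sub ((hd s).const_mul (κ : ℂ))).congr_deriv (by push_cast; ring))
    hgc hGc hgG a t
  have hI : |∫ s in b..t, Real.exp (κ * (t - s)) * G s|
      = |∫ x in (0 : ℝ)..(b - t), Real.exp (-(κ * x)) * G (t + x)| := by
    rw [intervalIntegral.integral_symm, abs_neg]
    have := intervalIntegral.integral_comp_add_left (a := 0) (b := b - t)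
      (fun s => Real.exp (κ * (t - s)) * G s) t
    rw [add_zero, add_sub_cancel] at this
    rw [← this]
    congr 1
    refine intervalIntegral.integral_congr fun x _ => ?_
    congr 2
    ring
  have hJ : |∫ s in a..t, Real.exp (-κ * (t - s)) * G s|
      = |∫ x in (0 : ℝ)..(t - a), Real.exp (-(κ * x)) * G (t - x)| := by
    have := intervalIntegral.integral_comp_sub_left (a := 0) (b := t - a)
      (fun s => Real.exp (-κ * (t - s)) * G s) t
    rw [sub_zero, sub_sub_cancel] at this
    rw [← this]
    congr 1
    refine intervalIntegral.integral_congr fun x _ => ?_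
    congr 2
    ring
  rw [hI] at hP
  rw [hJ] at hQ
  rw [hc2, hc2, hc2]
  have hexpb : Real.exp (κ * (t - b)) ^ 2 ≤ Real.exp (-(b - t)) := by
    rw [← Real.exp_nat_mul]
    refine Real.exp_le_exp.2 ?_
    push_cast
    nlinarith
  have hexpa : Real.exp (-κ * (t - a)) ^ 2 ≤ Real.exp (-(t - a)) := by
    rw [← Real.exp_nat_mul]
    refine Real.exp_le_exp.2 ?_
    push_cast
    nlinarith
  have hpb : ‖c₁ b + κ * c b‖ ^ 2 ≤ 2 * (‖c₁ b‖ ^ 2 + (κ * ‖c b‖) ^ 2) := by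
    have h1 := norm_add_le (c₁ b) (κ * c b)
    rw [norm_mul, Complex.norm_real, Real.norm_of_nonneg (by linarith)] at h1
    have := pow_le_pow_left₀ (norm_nonneg _) h1 2
    nlinarith [sq_nonneg (‖c₁ b‖ - κ * ‖c b‖)]
  have hqa : ‖c₁ a - κ * c a‖ ^ 2 ≤ 2 * (‖c₁ a‖ ^ 2 + (κ * ‖c a‖) ^ 2) := by
    have h1 := norm_sub_le (c₁ a) (κ * c a)
    rw [norm_mul, Complex.norm_real, Real.norm_of_nonneg (by linarith)] at h1
    have := pow_le_pow_left₀ (norm_nonneg _) h1 2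
    nlinarith [sq_nonneg (‖c₁ a‖ - κ * ‖c a‖)]
  have hct : 2 * (κ * ‖c t‖) ≤ ‖c₁ t + κ * c t‖ + ‖c₁ t - κ * c t‖ := by
    have h1 := norm_sub_le (c₁ t + κ * c t) (c₁ t - κ * c t)
    have h2 : c₁ t + κ * c t - (c₁ t - κ * c t) = (2 * κ : ℝ) * c t := by push_cast; ring
    rw [h2, norm_mul, Complex.norm_real, Real.norm_of_nonneg (by linarith)] at h1
    linarith
  have hA := mul_le_mul hexpb hpb (sq_nonneg _) (Real.exp_pos _).le
  have hB := mul_le_mul hexpa hqa (sq_nonneg _) (Real.exp_pos _).le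
  rw [← mul_pow] at hA hB
  have hκc : 0 ≤ κ * ‖c t‖ := by positivity
  generalize Real.exp (κ * (t - b)) * ‖c₁ b + κ * c b‖ = A at *
  generalize Real.exp (-κ * (t - a)) * ‖c₁ a - κ * c a‖ = B at *
  rw [← sq_abs (∫ x in (0 : ℝ)..(b - t), Real.exp (-(κ * x)) * G (t + x)),
    ← sq_abs (∫ x in (0 : ℝ)..(t - a), Real.exp (-(κ * x)) * G (t - x))]
  generalize |∫ x in (0 : ℝ)..(b - t), Real.exp (-(κ * x)) * G (t + x)| = I at *
  generalize |∫ x in (0 : ℝ)..(t - a), Real.exp (-(κ * x)) * G (t - x)| = J at *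
  have hsum : 2 * (κ * ‖c t‖) ≤ A + I + (B + J) := by linarith
  have := pow_le_pow_left₀ (by positivity) hsum 2
  nlinarith [sq_nonneg (A - I), sq_nonneg (A - B), sq_nonneg (A - J), sq_nonneg (I - B),
    sq_nonneg (I - J), sq_nonneg (B - J)]

lemma slice_estimate (hu : Continuous u) (hu₁ : Continuous u₁) (hu₂ : Continuous u₂)
    (hu₁₁ : Continuous u₁₁) (hu₂₂ : Continuous u₂₂)
    (h₁ : ∀ t θ, HasDerivAt (fun s => u (s, θ)) (u₁ (t, θ)) t)
    (h₁₁ : ∀ t θ, HasDerivAt (fun s => u₁ (s, θ)) (u₁₁ (t, θ)) t)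
    (h₂ : ∀ t θ, HasDerivAt (fun x => u (t, x)) (u₂ (t, θ)) θ)
    (h₂₂ : ∀ t θ, HasDerivAt (fun x => u₂ (t, x)) (u₂₂ (t, θ)) θ)
    (hp : ∀ t, u (t, 2 * π) = u (t, 0)) (hp₂ : ∀ t, u₂ (t, 2 * π) = u₂ (t, 0))
    {a b t : ℝ} (hat : a ≤ t) (htb : t ≤ b) {G : ℝ → ℝ} (hGc : Continuous G)
    (hG : ∀ t, ∫ θ in (0 : ℝ)..2 * π, |u₁₁ (t, θ) + u₂₂ (t, θ)| ≤ G t) :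
    ∫ θ in (0 : ℝ)..2 * π, u₂ (t, θ) ^ 2 ≤
      6 * (Real.exp (-(b - t)) * ((∫ θ in (0 : ℝ)..2 * π, u₁ (b, θ) ^ 2)
          + ∫ θ in (0 : ℝ)..2 * π, u₂ (b, θ) ^ 2)
        + Real.exp (-(t - a)) * ((∫ θ in (0 : ℝ)..2 * π, u₁ (a, θ) ^ 2)
          + ∫ θ in (0 : ℝ)..2 * π, u₂ (a, θ) ^ 2)
        + (∫ s in t..b, Real.exp (-(s - t)) * G s ^ 2)
        + ∫ s in a..t, Real.exp (-(t - s)) * G s ^ 2) := by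
  have hG0 : ∀ s, 0 ≤ G s := fun s => (intervalIntegral.integral_nonneg Real.two_pi_pos.le
    fun θ _ => abs_nonneg _).trans (hG s)
  have hS1 := sum_sq_integral_exp_mul_le (H := fun x => G (t + x)) (by fun_prop) (fun x => hG0 _)
    (sub_nonneg.2 htb)
  have hS2 := sum_sq_integral_exp_mul_le (H := fun x => G (t - x)) (by fun_prop) (fun x => hG0 _)
    (sub_nonneg.2 hat)
  have hI : ∫ x in (0 : ℝ)..(b - t), Real.exp (-x) * G (t + x) ^ 2
      = ∫ s in t..b, Real.exp (-(s - t)) * G s ^ 2 := by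
    have := intervalIntegral.integral_comp_add_left (a := 0) (b := b - t)
      (fun s => Real.exp (-(s - t)) * G s ^ 2) t
    rw [add_zero, add_sub_cancel] at this
    rw [← this]
    simp only [add_sub_cancel_left]
  have hJ : ∫ x in (0 : ℝ)..(t - a), Real.exp (-x) * G (t - x) ^ 2
      = ∫ s in a..t, Real.exp (-(t - s)) * G s ^ 2 := by
    have := intervalIntegral.integral_comp_sub_left (a := 0) (b := t - a)
      (fun s => Real.exp (-(t - s)) * G s ^ 2) t
    rw [sub_zero, sub_sub_cancel] at this
    rw [← this]
    simp only [sub_sub_cancel]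
  rw [hI] at hS1
  rw [hJ] at hS2
  have hbessel : ∀ (v : ℝ × ℝ → ℝ) (_ : Continuous v) (τ : ℝ) (s : Finset ℤ),
      ∑ k ∈ s, ‖fourierCoef k fun θ => v (τ, θ)‖ ^ 2
        ≤ 2 * π * ∫ θ in (0 : ℝ)..2 * π, v (τ, θ) ^ 2 := fun v hv τ s =>
    sum_le_hasSum s (fun _ _ => sq_nonneg _) (hasSum_sq_fourierCoef (by fun_prop))
  have hIn : 0 ≤ ∫ s in t..b, Real.exp (-(s - t)) * G s ^ 2 :=
    intervalIntegral.integral_nonneg htb fun s _ => by positivity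
  have hJn : 0 ≤ ∫ s in a..t, Real.exp (-(t - s)) * G s ^ 2 :=
    intervalIntegral.integral_nonneg hat fun s _ => by positivity
  have hmain : 2 * π * ∫ θ in (0 : ℝ)..2 * π, u₂ (t, θ) ^ 2 ≤
      2 * Real.exp (-(b - t)) * (2 * π * (∫ θ in (0 : ℝ)..2 * π, u₁ (b, θ) ^ 2)
          + 2 * π * ∫ θ in (0 : ℝ)..2 * π, u₂ (b, θ) ^ 2)
        + 2 * Real.exp (-(t - a)) * (2 * π * (∫ θ in (0 : ℝ)..2 * π, u₁ (a, θ) ^ 2)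
          + 2 * π * ∫ θ in (0 : ℝ)..2 * π, u₂ (a, θ) ^ 2)
        + 2 * (16 * ∫ s in t..b, Real.exp (-(s - t)) * G s ^ 2)
        + 2 * (16 * ∫ s in a..t, Real.exp (-(t - s)) * G s ^ 2) := by
    refine hasSum_le_of_sum_le (hasSum_sq_fourierCoef (h := fun θ => u₂ (t, θ)) (by fun_prop))
      fun s => ?_
    have h0 : fourierCoef 0 (fun θ => u₂ (t, θ)) = 0 := by
      rw [fourierCoef_deriv 0 (h₂ t) (by fun_prop) (hp t)]
      simp
    have hs : ∑ k ∈ s, ‖fourierCoef k fun θ => u₂ (t, θ)‖ ^ 2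
        = ∑ k ∈ s.erase 0, ‖fourierCoef k fun θ => u₂ (t, θ)‖ ^ 2 := by
      rw [Finset.sum_erase]
      rw [h0]
      simp
    rw [hs]
    refine (Finset.sum_le_sum fun k hk => sq_norm_fourierCoef_le hu hu₁ hu₂ hu₁₁ hu₂₂ h₁ h₁₁ h₂ h₂₂
      hp hp₂ hat htb (Finset.ne_of_mem_erase hk) hGc hG).trans ?_
    rw [Finset.sum_add_distrib, Finset.sum_add_distrib, Finset.sum_add_distrib, ← Finset.mul_sum,
      ← Finset.mul_sum, Finset.sum_add_distrib, Finset.sum_add_distrib]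
    refine add_le_add (add_le_add (add_le_add ?_ ?_) ?_) ?_
    · exact mul_le_mul_of_nonneg_left (add_le_add (hbessel _ hu₁ _ _) (hbessel _ hu₂ _ _))
        (by positivity)
    · exact mul_le_mul_of_nonneg_left (add_le_add (hbessel _ hu₁ _ _) (hbessel _ hu₂ _ _))
        (by positivity)
    · exact sum_natAbs_sub_one_le (F := fun i : ℕ => (∫ x in (0 : ℝ)..(b - t),
        Real.exp (-(((i : ℝ) + 1) * x)) * G (t + x)) ^ 2) (fun _ => sq_nonneg _) hS1 _
        (Finset.notMem_erase _ _)
    · exact sum_natAbs_sub_one_le (F := fun i : ℕ => (∫ x in (0 : ℝ)..(t - a),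
        Real.exp (-(((i : ℝ) + 1) * x)) * G (t - x)) ^ 2) (fun _ => sq_nonneg _) hS2 _
        (Finset.notMem_erase _ _)
  have hn : ∀ (v : ℝ × ℝ → ℝ) (τ : ℝ), 0 ≤ ∫ θ in (0 : ℝ)..2 * π, v (τ, θ) ^ 2 := fun v τ =>
    intervalIntegral.integral_nonneg Real.two_pi_pos.le fun θ _ => sq_nonneg _
  have hDb := mul_nonneg (Real.exp_pos (-(b - t))).le (add_nonneg (hn u₁ b) (hn u₂ b))
  have hDa := mul_nonneg (Real.exp_pos (-(t - a))).le (add_nonneg (hn u₁ a) (hn u₂ a))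
  have hpi := Real.pi_gt_three
  refine le_of_mul_le_mul_left (hmain.trans ?_) Real.two_pi_pos
  nlinarith [mul_nonneg (sub_nonneg.2 hpi.le) hDb, mul_nonneg (sub_nonneg.2 hpi.le) hDa,
    mul_nonneg (sub_nonneg.2 hpi.le) hIn, mul_nonneg (sub_nonneg.2 hpi.le) hJn]

end SliceEstimate

lemma integral_exp_mul_le_of_windows {β : ℝ → ℝ} (hβ : Continuous β) (hβ0 : ∀ s, 0 ≤ β s)
    {p q η : ℝ} (hpq : p + 1 ≤ q)
    (hw : ∀ c ∈ Icc p (q - 1), ∫ s in c..c + 1, β s ≤ η) {t b : ℝ} (hpt : p ≤ t) (htb : t ≤ b)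
    (hbq : b ≤ q) :
    ∫ s in t..b, Real.exp (-(s - t) / 2) * β s ≤ 3 * η := by
  have hη : 0 ≤ η := (intervalIntegral.integral_nonneg (by linarith) fun s _ => hβ0 s).trans
    (hw p ⟨le_rfl, by linarith⟩)
  have hshort : ∀ t b : ℝ, p ≤ t → t ≤ b → b ≤ q → b ≤ t + 1 →
      ∫ s in t..b, Real.exp (-(s - t) / 2) * β s ≤ η := by
    intro t b hpt htb hbq hb1
    have hc1 : p ≤ min t (q - 1) := le_min hpt (by linarith)
    have hc2 : b ≤ min t (q - 1) + 1 := by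
      rcases min_choice t (q - 1) with h | h <;> rw [h] <;> linarith
    calc ∫ s in t..b, Real.exp (-(s - t) / 2) * β s ≤ ∫ s in t..b, β s := by
          refine intervalIntegral.integral_mono_on htb
            (Continuous.intervalIntegrable (by fun_prop) _ _) (hβ.intervalIntegrable _ _)
            fun s hs => ?_
          refine mul_le_of_le_one_left (hβ0 s) (Real.exp_le_one_iff.2 ?_)
          linarith [hs.1]
      _ ≤ ∫ s in min t (q - 1)..min t (q - 1) + 1, β s :=
          intervalIntegral.integral_mono_interval (min_le_left _ _) htb hc2
            (Eventually.of_forall hβ0) (hβ.intervalIntegrable _ _)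
      _ ≤ η := hw _ ⟨hc1, min_le_right _ _⟩
  suffices h : ∀ (N : ℕ) (t : ℝ), p ≤ t → t ≤ b → b ≤ t + N →
      ∫ s in t..b, Real.exp (-(s - t) / 2) * β s ≤ 3 * η by
    obtain ⟨N, hN⟩ := exists_nat_ge (b - t)
    exact h N t hpt htb (by linarith)
  intro N
  induction N with
  | zero =>
    intro t hpt htb hN
    have : t = b := le_antisymm htb (by simpa using hN)
    rw [this, intervalIntegral.integral_same]
    linarith
  | succ N ih =>
    intro t hpt htb hN
    rcases le_total b (t + 1) with h1 | h1
    · linarith [hshort t b hpt htb hbq h1]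
    · have hci : ∀ x y, IntervalIntegrable (fun s => Real.exp (-(s - t) / 2) * β s) volume x y :=
        fun x y => Continuous.intervalIntegrable (by fun_prop) _ _
      rw [← intervalIntegral.integral_add_adjacent_intervals (hci t (t + 1)) (hci (t + 1) b)]
      have h2 := hshort t (t + 1) hpt (by linarith) (by linarith) le_rfl
      have h3 := ih (t + 1) (by linarith) h1 (by push_cast at hN; linarith)
      have h4 : ∫ s in (t + 1)..b, Real.exp (-(s - t) / 2) * β s
          = Real.exp (-(1 / 2)) * ∫ s in (t + 1)..b, Real.exp (-(s - (t + 1)) / 2) * β s := by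
        rw [← intervalIntegral.integral_const_mul]
        refine intervalIntegral.integral_congr fun s _ => ?_
        rw [← mul_assoc, ← Real.exp_add]
        congr 2
        ring
      have h5 : Real.exp (-(1 / 2)) ≤ 2 / 3 := by
        rw [Real.exp_neg, inv_le_comm₀ (Real.exp_pos _) (by norm_num)]
        linarith [Real.add_one_le_exp (1 / 2 : ℝ)]
      rw [h4]
      have h6 := mul_le_mul_of_nonneg_left h3 (Real.exp_pos (-(1 / 2))).le
      have h7 := mul_le_mul_of_nonneg_right h5 (by positivity : (0 : ℝ) ≤ 3 * η)
      linarith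

lemma integral_exp_mul_le_of_windows_left {β : ℝ → ℝ} (hβ : Continuous β) (hβ0 : ∀ s, 0 ≤ β s)
    {p q η : ℝ} (hpq : p + 1 ≤ q)
    (hw : ∀ c ∈ Icc p (q - 1), ∫ s in c..c + 1, β s ≤ η) {a t : ℝ} (hpa : p ≤ a) (hat : a ≤ t)
    (htq : t ≤ q) :
    ∫ s in a..t, Real.exp (-(t - s) / 2) * β s ≤ 3 * η := by
  have h := integral_exp_mul_le_of_windows (β := fun s => β (-s)) (p := -q) (q := -p) (η := η)
    (by fun_prop) (fun s => hβ0 _) (by linarith) (fun c hc => ?_) (t := -t) (b := -a)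
    (by linarith) (by linarith) (by linarith)
  · have e := intervalIntegral.integral_comp_neg (a := -t) (b := -a)
      (fun s => Real.exp (-(t - s) / 2) * β s)
    simp only [neg_neg] at e
    rw [← e]
    refine le_trans (le_of_eq ?_) h
    refine intervalIntegral.integral_congr fun s _ => ?_
    congr 2
    ring
  · have e := intervalIntegral.integral_comp_neg (a := c) (b := c + 1) β
    rw [e]
    have := hw (-(c + 1)) ⟨by linarith [hc.2], by linarith [hc.1]⟩
    rwa [show -(c + 1) + 1 = -c by ring] at this

/-- A weighted absorption argument for an integral inequality with exponentially decaying kernel. -/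
lemma le_of_exp_kernel_inequality {e β w : ℝ → ℝ} (he : Continuous e) (hβ : Continuous β)
    (hw : Continuous w) (he0 : ∀ s, 0 ≤ e s) (hβ0 : ∀ s, 0 ≤ β s) (hw0 : ∀ s, 0 < w s)
    (hww : ∀ s t, w s ≤ Real.exp (|s - t| / 2) * w t) {a b A B η : ℝ} (hB : 0 ≤ B)
    (hBη : B * (6 * η) ≤ 1 / 2)
    (hE : ∀ t ∈ Icc a b, e t ≤ A * w t + B * ((∫ s in t..b, Real.exp (-(s - t)) * (β s * e s))
      + ∫ s in a..t, Real.exp (-(t - s)) * (β s * e s)))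
    (hr : ∀ t ∈ Icc a b, ∫ s in t..b, Real.exp (-(s - t) / 2) * β s ≤ 3 * η)
    (hl : ∀ t ∈ Icc a b, ∫ s in a..t, Real.exp (-(t - s) / 2) * β s ≤ 3 * η)
    {t : ℝ} (ht : t ∈ Icc a b) : e t ≤ 2 * A * w t := by
  obtain ⟨τ, hτ, hmax⟩ := isCompact_Icc.exists_isMaxOn ⟨t, ht⟩
    ((he.div hw fun s => (hw0 s).ne').continuousOn (s := Icc a b))
  set M := e τ / w τ with hM
  have hM0 : 0 ≤ M := div_nonneg (he0 _) (hw0 _).le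
  have hle : ∀ s ∈ Icc a b, e s ≤ M * w s := fun s hs => by
    have : e s / w s ≤ M := hmax hs
    rwa [div_le_iff₀ (hw0 s)] at this
  have heτ : e τ = M * w τ := by rw [hM, div_mul_cancel₀ _ (hw0 τ).ne']
  have hI : ∫ s in τ..b, Real.exp (-(s - τ)) * (β s * e s) ≤ M * w τ * (3 * η) := by
    refine le_trans ?_ (mul_le_mul_of_nonneg_left (hr τ hτ) (mul_nonneg hM0 (hw0 τ).le))
    rw [← intervalIntegral.integral_const_mul]
    refine intervalIntegral.integral_mono_on hτ.2 (Continuous.intervalIntegrable (by fun_prop) _ _)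
      (Continuous.intervalIntegrable (by fun_prop) _ _) fun s hs => ?_
    have h1 := hww s τ
    rw [abs_of_nonneg (sub_nonneg.2 hs.1)] at h1
    have h2 : e s ≤ M * (Real.exp ((s - τ) / 2) * w τ) :=
      (hle s ⟨hτ.1.trans hs.1, hs.2⟩).trans (mul_le_mul_of_nonneg_left h1 hM0)
    have h3 : Real.exp (-(s - τ)) * Real.exp ((s - τ) / 2) = Real.exp (-(s - τ) / 2) := by
      rw [← Real.exp_add]; ring_nf
    calc Real.exp (-(s - τ)) * (β s * e s)
        ≤ Real.exp (-(s - τ)) * (β s * (M * (Real.exp ((s - τ) / 2) * w τ))) := by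
          have := hβ0 s
          gcongr
      _ = M * w τ * ((Real.exp (-(s - τ)) * Real.exp ((s - τ) / 2)) * β s) := by ring
      _ = _ := by rw [h3]
  have hJ : ∫ s in a..τ, Real.exp (-(τ - s)) * (β s * e s) ≤ M * w τ * (3 * η) := by
    refine le_trans ?_ (mul_le_mul_of_nonneg_left (hl τ hτ) (mul_nonneg hM0 (hw0 τ).le))
    rw [← intervalIntegral.integral_const_mul]
    refine intervalIntegral.integral_mono_on hτ.1 (Continuous.intervalIntegrable (by fun_prop) _ _)
      (Continuous.intervalIntegrable (by fun_prop) _ _) fun s hs => ?_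
    have h1 := hww s τ
    rw [abs_of_nonpos (sub_nonpos.2 hs.2), neg_sub] at h1
    have h2 : e s ≤ M * (Real.exp ((τ - s) / 2) * w τ) :=
      (hle s ⟨hs.1, hs.2.trans hτ.2⟩).trans (mul_le_mul_of_nonneg_left h1 hM0)
    have h3 : Real.exp (-(τ - s)) * Real.exp ((τ - s) / 2) = Real.exp (-(τ - s) / 2) := by
      rw [← Real.exp_add]; ring_nf
    calc Real.exp (-(τ - s)) * (β s * e s)
        ≤ Real.exp (-(τ - s)) * (β s * (M * (Real.exp ((τ - s) / 2) * w τ))) := by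
          have := hβ0 s
          gcongr
      _ = M * w τ * ((Real.exp (-(τ - s)) * Real.exp ((τ - s) / 2)) * β s) := by ring
      _ = _ := by rw [h3]
  have hmul := mul_le_mul_of_nonneg_left (add_le_add hI hJ) hB
  have hmul2 := mul_le_mul_of_nonneg_right hBη (mul_nonneg hM0 (hw0 τ).le)
  have hfin : M * w τ ≤ 2 * A * w τ := by
    have := hE τ hτ
    rw [heτ] at this
    nlinarith
  exact (hle t ht).trans (mul_le_mul_of_nonneg_right (le_of_mul_le_mul_right hfin (hw0 τ))
    (hw0 t).le)

lemma sq_integral_mul_le {p q : ℝ → ℝ} (hp : Continuous p) (hq : Continuous q) {a b : ℝ}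
    (hab : a ≤ b) (hpos : 0 < ∫ x in a..b, q x ^ 2) :
    (∫ x in a..b, p x * q x) ^ 2 ≤ (∫ x in a..b, p x ^ 2) * ∫ x in a..b, q x ^ 2 := by
  set P := ∫ x in a..b, p x ^ 2 with hP
  set Q := ∫ x in a..b, q x ^ 2 with hQ
  set R := ∫ x in a..b, p x * q x with hR
  have h : 0 ≤ ∫ x in a..b, (Q ^ 2 * p x ^ 2 - 2 * Q * R * (p x * q x) + R ^ 2 * q x ^ 2) :=
    intervalIntegral.integral_nonneg hab fun x _ => by nlinarith [sq_nonneg (Q * p x - R * q x)]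
  rw [intervalIntegral.integral_add (Continuous.intervalIntegrable (by fun_prop) _ _)
      (Continuous.intervalIntegrable (by fun_prop) _ _),
    intervalIntegral.integral_sub (Continuous.intervalIntegrable (by fun_prop) _ _)
      (Continuous.intervalIntegrable (by fun_prop) _ _),
    intervalIntegral.integral_const_mul, intervalIntegral.integral_const_mul,
    intervalIntegral.integral_const_mul, ← hP, ← hQ, ← hR] at h
  have h2 : 0 ≤ Q * (P * Q - R ^ 2) := by nlinarith
  linarith [nonneg_of_mul_nonneg_right h2 hpos]

lemma exists_le_integral_unit {e : ℝ → ℝ} (he : Continuous e) (p : ℝ) :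
    ∃ a ∈ Icc p (p + 1), e a ≤ ∫ s in p..p + 1, e s := by
  obtain ⟨a, ha, hmin⟩ := isCompact_Icc.exists_isMinOn ⟨p, left_mem_Icc.2 (by linarith)⟩
    (he.continuousOn (s := Icc p (p + 1)))
  refine ⟨a, ha, ?_⟩
  have := intervalIntegral.integral_mono_on (f := fun _ => e a) (μ := volume) (by linarith : p ≤ p + 1)
    (continuous_const.intervalIntegrable p (p + 1)) (he.intervalIntegrable p (p + 1)) fun s hs => hmin hs
  simpa using this

section Surface

variable {n : ℕ} {f : ℝ × ℝ → EuclideanSpace ℝ (Fin n)}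

lemma ContDiff.pd1 (hf : ContDiff ℝ (⊤ : ℕ∞) f) : ContDiff ℝ (⊤ : ℕ∞) (pd1 f) :=
  (hf.fderiv_right (m := (⊤ : ℕ∞)) (by simp)).clm_apply contDiff_const

lemma ContDiff.pd2 (hf : ContDiff ℝ (⊤ : ℕ∞) f) : ContDiff ℝ (⊤ : ℕ∞) (pd2 f) :=
  (hf.fderiv_right (m := (⊤ : ℕ∞)) (by simp)).clm_apply contDiff_const

lemma ContDiff.hasDerivAt_pd1 (hf : ContDiff ℝ (⊤ : ℕ∞) f) (t θ : ℝ) :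
    HasDerivAt (fun s => f (s, θ)) (_root_.pd1 f (t, θ)) t :=
  (hf.differentiable (by simp) (t, θ)).hasFDerivAt.comp_hasDerivAt t
    ((hasDerivAt_id t).prodMk (hasDerivAt_const t θ))

lemma ContDiff.hasDerivAt_pd2 (hf : ContDiff ℝ (⊤ : ℕ∞) f) (t θ : ℝ) :
    HasDerivAt (fun x => f (t, x)) (_root_.pd2 f (t, θ)) θ :=
  (hf.differentiable (by simp) (t, θ)).hasFDerivAt.comp_hasDerivAt θ
    ((hasDerivAt_const θ t).prodMk (hasDerivAt_id θ))

lemma HasDerivAt.euclidean_apply {g : ℝ → EuclideanSpace ℝ (Fin n)}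
    {g' : EuclideanSpace ℝ (Fin n)} {t : ℝ} (h : HasDerivAt g g' t) (j : Fin n) :
    HasDerivAt (fun s => g s j) (g' j) t :=
  (EuclideanSpace.proj (𝕜 := ℝ) j).hasFDerivAt.comp_hasDerivAt t h

lemma pd2_periodic (hp : ∀ t θ : ℝ, f (t, θ + 2 * π) = f (t, θ)) (hf : ContDiff ℝ (⊤ : ℕ∞) f)
    (t θ : ℝ) : pd2 f (t, θ + 2 * π) = pd2 f (t, θ) := by
  have h1 := (hf.hasDerivAt_pd2 t (θ + 2 * π)).comp_add_const θ (2 * π)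
  simp only [hp] at h1
  exact h1.unique (hf.hasDerivAt_pd2 t θ)

/-- The angular energy of the slice at `t`. -/
noncomputable def sliceEnergy (f : ℝ × ℝ → EuclideanSpace ℝ (Fin n)) (t : ℝ) : ℝ :=
  ∫ θ in (0 : ℝ)..2 * π, ‖pd2 f (t, θ)‖ ^ 2

lemma sliceEnergy_nonneg (f : ℝ × ℝ → EuclideanSpace ℝ (Fin n)) (t : ℝ) : 0 ≤ sliceEnergy f t :=
  intervalIntegral.integral_nonneg Real.two_pi_pos.le fun _ _ => sq_nonneg _

lemma continuous_sliceEnergy (hf : ContDiff ℝ (⊤ : ℕ∞) f) : Continuous (sliceEnergy f) :=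
  continuous_slice_integral (F := fun z => ‖pd2 f z‖ ^ 2) (hf.pd2.continuous.norm.pow 2) _ _

lemma sum_integral_sq_apply {g : ℝ → EuclideanSpace ℝ (Fin n)} (hg : Continuous g) (a b : ℝ) :
    ∑ j, ∫ θ in a..b, g θ j ^ 2 = ∫ θ in a..b, ‖g θ‖ ^ 2 := by
  rw [← intervalIntegral.integral_finsetSum
    fun j _ => Continuous.intervalIntegrable (by fun_prop) _ _]
  refine intervalIntegral.integral_congr fun θ _ => ?_
  rw [EuclideanSpace.real_norm_sq_eq]

lemma continuous_lap (hf : ContDiff ℝ (⊤ : ℕ∞) f) : Continuous (lap f) :=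
  hf.pd1.pd1.continuous.add hf.pd2.pd2.continuous

lemma sliceEnergy_le (hf : ContDiff ℝ (⊤ : ℕ∞) f) (hp : ∀ t θ : ℝ, f (t, θ + 2 * π) = f (t, θ))
    (hconf : ∀ z, ‖pd1 f z‖ ^ 2 = ‖pd2 f z‖ ^ 2) {a b t : ℝ} (hat : a ≤ t) (htb : t ≤ b) :
    sliceEnergy f t ≤ 12 * (Real.exp (-(b - t)) * sliceEnergy f b
        + Real.exp (-(t - a)) * sliceEnergy f a)
      + 6 * n * ((∫ s in t..b, Real.exp (-(s - t)) * (∫ θ in (0 : ℝ)..2 * π, ‖lap f (s, θ)‖) ^ 2)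
        + ∫ s in a..t, Real.exp (-(t - s)) * (∫ θ in (0 : ℝ)..2 * π, ‖lap f (s, θ)‖) ^ 2) := by
  have c0 := hf.continuous
  have c1 := hf.pd1.continuous
  have c2 := hf.pd2.continuous
  have c11 := hf.pd1.pd1.continuous
  have c22 := hf.pd2.pd2.continuous
  have cl := continuous_lap hf
  have hG : Continuous fun s => ∫ θ in (0 : ℝ)..2 * π, ‖lap f (s, θ)‖ :=
    continuous_slice_integral (F := fun z => ‖lap f z‖) cl.norm _ _
  have hE2 : ∀ τ, ∑ j, ∫ θ in (0 : ℝ)..2 * π, pd2 f (τ, θ) j ^ 2 = sliceEnergy f τ := fun τ =>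
    sum_integral_sq_apply (g := fun θ => pd2 f (τ, θ)) (by fun_prop) _ _
  have hE1 : ∀ τ, ∑ j, ∫ θ in (0 : ℝ)..2 * π, pd1 f (τ, θ) j ^ 2 = sliceEnergy f τ := fun τ => by
    rw [sum_integral_sq_apply (g := fun θ => pd1 f (τ, θ)) (by fun_prop)]
    exact intervalIntegral.integral_congr fun θ _ => hconf _
  have hj : ∀ j : Fin n, _ := fun j => slice_estimate (u := fun z => f z j)
    (u₁ := fun z => pd1 f z j) (u₂ := fun z => pd2 f z j) (u₁₁ := fun z => pd1 (pd1 f) z j)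
    (u₂₂ := fun z => pd2 (pd2 f) z j) (by fun_prop) (by fun_prop) (by fun_prop) (by fun_prop)
    (by fun_prop) (fun t θ => (hf.hasDerivAt_pd1 t θ).euclidean_apply j)
    (fun t θ => (hf.pd1.hasDerivAt_pd1 t θ).euclidean_apply j)
    (fun t θ => (hf.hasDerivAt_pd2 t θ).euclidean_apply j)
    (fun t θ => (hf.pd2.hasDerivAt_pd2 t θ).euclidean_apply j)
    (fun t => by simpa using congrArg (fun v => v j) (hp t 0))
    (fun t => by simpa using congrArg (fun v => v j) (pd2_periodic hp hf t 0))
    hat htb hG (fun t => by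
      refine intervalIntegral.integral_mono_on Real.two_pi_pos.le
        (Continuous.intervalIntegrable (by fun_prop) _ _)
        (Continuous.intervalIntegrable (by fun_prop) _ _) fun θ _ => ?_
      exact PiLp.norm_apply_le (lap f (t, θ)) j)
  have hsum := Finset.sum_le_sum fun j (_ : j ∈ Finset.univ) => hj j
  rw [hE2, ← Finset.mul_sum, Finset.sum_add_distrib, Finset.sum_add_distrib,
    Finset.sum_add_distrib, ← Finset.mul_sum, ← Finset.mul_sum, Finset.sum_add_distrib,
    Finset.sum_add_distrib, hE1, hE2, hE1, hE2, Finset.sum_const, Finset.sum_const,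
    Finset.card_univ, Fintype.card_fin, nsmul_eq_mul, nsmul_eq_mul] at hsum
  linarith

/-- The regularized Willmore density of the slice at `t`. -/
noncomputable def sliceWillmore (f : ℝ × ℝ → EuclideanSpace ℝ (Fin n)) (δ t : ℝ) : ℝ :=
  ∫ θ in (0 : ℝ)..2 * π, ‖lap f (t, θ)‖ ^ 2 / (gradSq f (t, θ) + δ)

lemma gradSq_nonneg (f : ℝ × ℝ → EuclideanSpace ℝ (Fin n)) (z : ℝ × ℝ) : 0 ≤ gradSq f z := by
  unfold gradSq; positivity

lemma continuous_gradSq (hf : ContDiff ℝ (⊤ : ℕ∞) f) : Continuous (gradSq f) :=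
  (hf.pd1.continuous.norm.pow 2).add (hf.pd2.continuous.norm.pow 2)

lemma continuous_willmore_density (hf : ContDiff ℝ (⊤ : ℕ∞) f) {δ : ℝ} (hδ : 0 < δ) :
    Continuous fun z => ‖lap f z‖ ^ 2 / (gradSq f z + δ) :=
  ((continuous_lap hf).norm.pow 2).div ((continuous_gradSq hf).add continuous_const)
    fun z => (add_pos_of_nonneg_of_pos (gradSq_nonneg f z) hδ).ne'

lemma sliceWillmore_nonneg (f : ℝ × ℝ → EuclideanSpace ℝ (Fin n)) {δ : ℝ} (hδ : 0 < δ) (t : ℝ) :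
    0 ≤ sliceWillmore f δ t :=
  intervalIntegral.integral_nonneg Real.two_pi_pos.le fun θ _ => by
    have := gradSq_nonneg f (t, θ)
    positivity

lemma sq_integral_lap_le (hf : ContDiff ℝ (⊤ : ℕ∞) f)
    (hconf : ∀ z, ‖pd1 f z‖ ^ 2 = ‖pd2 f z‖ ^ 2) {δ : ℝ} (hδ : 0 < δ) (t : ℝ) :
    (∫ θ in (0 : ℝ)..2 * π, ‖lap f (t, θ)‖) ^ 2
      ≤ sliceWillmore f δ t * (2 * (sliceEnergy f t + π * δ)) := by
  have cl := continuous_lap hf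
  have cg := continuous_gradSq hf
  have c2 := hf.pd2.continuous
  have hpos : ∀ z, 0 < gradSq f z + δ := fun z =>
    add_pos_of_nonneg_of_pos (gradSq_nonneg f z) hδ
  have hs : ∀ z, 0 < √(gradSq f z + δ) := fun z => Real.sqrt_pos.2 (hpos z)
  have hq : ∫ θ in (0 : ℝ)..2 * π, √(gradSq f (t, θ) + δ) ^ 2
      = 2 * (sliceEnergy f t + π * δ) := by
    have h1 : ∀ θ, √(gradSq f (t, θ) + δ) ^ 2 = 2 * ‖pd2 f (t, θ)‖ ^ 2 + δ := fun θ => by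
      rw [Real.sq_sqrt (hpos _).le, gradSq, hconf]; ring
    simp only [h1]
    rw [intervalIntegral.integral_add (Continuous.intervalIntegrable (by fun_prop) _ _)
      (Continuous.intervalIntegrable (by fun_prop) _ _), intervalIntegral.integral_const_mul,
      intervalIntegral.integral_const, sliceEnergy, smul_eq_mul]
    ring
  have hpi := Real.pi_pos
  have hE := sliceEnergy_nonneg f t
  have key := sq_integral_mul_le (p := fun θ => ‖lap f (t, θ)‖ / √(gradSq f (t, θ) + δ))
    (q := fun θ => √(gradSq f (t, θ) + δ))
    (Continuous.div (by fun_prop) (by fun_prop) fun θ => (hs _).ne') (by fun_prop)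
    Real.two_pi_pos.le (by rw [hq]; positivity)
  rw [hq] at key
  simp only [div_mul_cancel₀ _ (hs _).ne', div_pow, Real.sq_sqrt (hpos _).le] at key
  exact key

lemma integral_prod_Icc {F : ℝ × ℝ → ℝ} (hF : Continuous F) {a b c d : ℝ} (hab : a ≤ b)
    (hcd : c ≤ d) :
    ∫ z in Icc a b ×ˢ Icc c d, F z = ∫ s in a..b, ∫ θ in c..d, F (s, θ) := by
  rw [Measure.volume_eq_prod, setIntegral_prod _
    ((hF.continuousOn).integrableOn_compact (isCompact_Icc.prod isCompact_Icc)),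
    intervalIntegral.integral_of_le hab, integral_Icc_eq_integral_Ioc]
  refine setIntegral_congr_fun measurableSet_Ioc fun s _ => ?_
  rw [intervalIntegral.integral_of_le hcd, integral_Icc_eq_integral_Ioc]

lemma integral_sliceWillmore_le (hf : ContDiff ℝ (⊤ : ℕ∞) f)
    (hlap : ∀ z, fderiv ℝ f z = 0 → lap f z = 0) {δ : ℝ} (hδ : 0 < δ) {c η : ℝ} (hη : 0 ≤ η)
    (hW : willmore f (Icc c (c + 1) ×ˢ Icc 0 (2 * π)) < ENNReal.ofReal η) :
    ∫ s in c..c + 1, sliceWillmore f δ s ≤ η := by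
  have hcont := continuous_willmore_density hf hδ
  have hnn : ∀ z, 0 ≤ ‖lap f z‖ ^ 2 / (gradSq f z + δ) := fun z => by
    have := gradSq_nonneg f z
    positivity
  have hS : MeasurableSet {w | gradSq f w ≠ 0} :=
    (isOpen_ne_fun (continuous_gradSq hf) continuous_const).measurableSet
  have hzero : ∀ z, gradSq f z = 0 → lap f z = 0 := by
    intro z hz
    refine hlap z (ContinuousLinearMap.ext fun v => ?_)
    have h1 : pd1 f z = 0 := by
      unfold gradSq at hz
      have : ‖pd1 f z‖ ^ 2 = 0 := by nlinarith [sq_nonneg ‖pd1 f z‖, sq_nonneg ‖pd2 f z‖]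
      simpa using this
    have h2 : pd2 f z = 0 := by
      unfold gradSq at hz
      have : ‖pd2 f z‖ ^ 2 = 0 := by nlinarith [sq_nonneg ‖pd1 f z‖, sq_nonneg ‖pd2 f z‖]
      simpa using this
    have hv : v = v.1 • ((1 : ℝ), (0 : ℝ)) + v.2 • ((0 : ℝ), (1 : ℝ)) := by
      ext <;> simp
    rw [hv, map_add, map_smul, map_smul]
    change v.1 • pd1 f z + v.2 • pd2 f z = 0
    rw [h1, h2]; simp
  have hle : ENNReal.ofReal (∫ z in Icc c (c + 1) ×ˢ Icc 0 (2 * π),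
      ‖lap f z‖ ^ 2 / (gradSq f z + δ)) ≤ willmore f (Icc c (c + 1) ×ˢ Icc 0 (2 * π)) := by
    rw [ofReal_integral_eq_lintegral_ofReal
      (hcont.continuousOn.integrableOn_compact (isCompact_Icc.prod isCompact_Icc))
      (Eventually.of_forall hnn), ← lintegral_inter_add_sdiff _ _ hS, willmore]
    have hd : ∫⁻ z in (Icc c (c + 1) ×ˢ Icc 0 (2 * π)) \ {w | gradSq f w ≠ 0},
        ENNReal.ofReal (‖lap f z‖ ^ 2 / (gradSq f z + δ)) = 0 := by
      refine setLIntegral_eq_zero ((measurableSet_Icc.prod measurableSet_Icc).diff hS)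
        fun z hz => ?_
      have : gradSq f z = 0 := not_not.1 hz.2
      simp [hzero z this]
    rw [hd, add_zero]
    refine setLIntegral_mono' ((measurableSet_Icc.prod measurableSet_Icc).inter hS) fun z hz => ?_
    refine ENNReal.ofReal_le_ofReal ?_
    have hz0 : 0 < gradSq f z := lt_of_le_of_ne (gradSq_nonneg f z) (Ne.symm hz.2)
    gcongr
    linarith
  have hfin := hle.trans hW.le
  rw [ENNReal.ofReal_le_ofReal_iff hη, integral_prod_Icc hcont (by linarith)
    Real.two_pi_pos.le] at hfin
  exact hfin

lemma sliceEnergy_decay (hn : 1 ≤ n) (hf : ContDiff ℝ (⊤ : ℕ∞) f)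
    (hp : ∀ t θ : ℝ, f (t, θ + 2 * π) = f (t, θ))
    (hconf : ∀ z, ‖pd1 f z‖ ^ 2 = ‖pd2 f z‖ ^ 2)
    (hlap : ∀ z, fderiv ℝ f z = 0 → lap f z = 0) {p q : ℝ} (hpq : p + 1 ≤ q)
    (hW : ∀ s ∈ Icc p (q - 1), willmore f (Icc s (s + 1) ×ˢ Icc 0 (2 * π))
      < ENNReal.ofReal ((1 / (12 * n)) ^ 2))
    {a b t : ℝ} (hpa : p ≤ a) (hbq : b ≤ q) (hat : a ≤ t) (htb : t ≤ b) :
    sliceEnergy f t ≤ 24 * (Real.exp (-(b - t) / 2) * sliceEnergy f b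
      + Real.exp (-(t - a) / 2) * sliceEnergy f a) := by
  have hn' : (1 : ℝ) ≤ n := by exact_mod_cast hn
  have hpi := Real.pi_pos
  have hEb := sliceEnergy_nonneg f b
  have hEa := sliceEnergy_nonneg f a
  have hEc := continuous_sliceEnergy hf
  have hδ : ∀ δ : ℝ, 0 < δ → sliceEnergy f t + π * δ ≤
      2 * 12 * (Real.exp (-(b - t) / 2) * sliceEnergy f b
        + Real.exp (-(t - a) / 2) * sliceEnergy f a + π * δ) := by
    intro δ hδ
    have hβc : Continuous (sliceWillmore f δ) :=
      continuous_slice_integral (F := fun z => ‖lap f z‖ ^ 2 / (gradSq f z + δ))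
        (continuous_willmore_density hf hδ) _ _
    have hβ0 := sliceWillmore_nonneg f hδ
    have hwin : ∀ c ∈ Icc p (q - 1), ∫ s in c..c + 1, sliceWillmore f δ s
        ≤ (1 / (12 * (n : ℝ))) ^ 2 := fun c hc =>
      integral_sliceWillmore_le hf hlap hδ (sq_nonneg _) (hW c hc)
    have hGc : Continuous fun s => ∫ θ in (0 : ℝ)..2 * π, ‖lap f (s, θ)‖ :=
      continuous_slice_integral (F := fun z => ‖lap f z‖) (continuous_lap hf).norm _ _
    refine le_of_exp_kernel_inequality (e := fun s => sliceEnergy f s + π * δ)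
      (β := sliceWillmore f δ) (w := fun s => Real.exp (-(b - s) / 2) * sliceEnergy f b
        + Real.exp (-(s - a) / 2) * sliceEnergy f a + π * δ) (a := a) (b := b) (A := 12)
      (B := 12 * n) (η := (1 / (12 * (n : ℝ))) ^ 2) (by fun_prop) hβc (by fun_prop)
      (fun s => add_nonneg (sliceEnergy_nonneg f s) (by positivity)) hβ0 (fun s => by positivity)
      (fun s τ => ?_) (by positivity) ?_ (fun τ hτ => ?_) (fun τ hτ => ?_) (fun τ hτ => ?_)
      ⟨hat, htb⟩
    · have h1 : Real.exp (-(b - s) / 2) ≤ Real.exp (|s - τ| / 2) * Real.exp (-(b - τ) / 2) := by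
        rw [← Real.exp_add]
        refine Real.exp_le_exp.2 ?_
        linarith [le_abs_self (s - τ)]
      have h2 : Real.exp (-(s - a) / 2) ≤ Real.exp (|s - τ| / 2) * Real.exp (-(τ - a) / 2) := by
        rw [← Real.exp_add]
        refine Real.exp_le_exp.2 ?_
        linarith [neg_abs_le (s - τ)]
      have h3 : 1 ≤ Real.exp (|s - τ| / 2) := Real.one_le_exp (by positivity)
      have h4 := mul_le_mul_of_nonneg_right h1 hEb
      have h5 := mul_le_mul_of_nonneg_right h2 hEa
      have h6 := mul_le_mul_of_nonneg_right h3 (by positivity : 0 ≤ π * δ)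
      linarith
    · have : 12 * (n : ℝ) * (6 * (1 / (12 * (n : ℝ))) ^ 2) = 1 / (2 * n) := by
        field_simp
        norm_num
      rw [this]
      exact one_div_le_one_div_of_le (by norm_num) (by linarith)
    · have h0 := sliceEnergy_le hf hp hconf hτ.1 hτ.2
      have h1 : Real.exp (-(b - τ)) ≤ Real.exp (-(b - τ) / 2) :=
        Real.exp_le_exp.2 (by linarith [hτ.2])
      have h2 : Real.exp (-(τ - a)) ≤ Real.exp (-(τ - a) / 2) :=
        Real.exp_le_exp.2 (by linarith [hτ.1])
      have h3 := mul_le_mul_of_nonneg_right h1 hEb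
      have h4 := mul_le_mul_of_nonneg_right h2 hEa
      have h5 : ∫ s in τ..b, Real.exp (-(s - τ)) * (∫ θ in (0 : ℝ)..2 * π, ‖lap f (s, θ)‖) ^ 2
          ≤ 2 * ∫ s in τ..b,
            Real.exp (-(s - τ)) * (sliceWillmore f δ s * (sliceEnergy f s + π * δ)) := by
        rw [← intervalIntegral.integral_const_mul]
        refine intervalIntegral.integral_mono_on hτ.2
          (Continuous.intervalIntegrable (by fun_prop) _ _)
          (Continuous.intervalIntegrable (by fun_prop) _ _) fun s _ => ?_
        have := mul_le_mul_of_nonneg_left (sq_integral_lap_le hf hconf hδ s)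
          (Real.exp_pos (-(s - τ))).le
        linarith
      have h6 : ∫ s in a..τ, Real.exp (-(τ - s)) * (∫ θ in (0 : ℝ)..2 * π, ‖lap f (s, θ)‖) ^ 2
          ≤ 2 * ∫ s in a..τ,
            Real.exp (-(τ - s)) * (sliceWillmore f δ s * (sliceEnergy f s + π * δ)) := by
        rw [← intervalIntegral.integral_const_mul]
        refine intervalIntegral.integral_mono_on hτ.1
          (Continuous.intervalIntegrable (by fun_prop) _ _)
          (Continuous.intervalIntegrable (by fun_prop) _ _) fun s _ => ?_
        have := mul_le_mul_of_nonneg_left (sq_integral_lap_le hf hconf hδ s)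
          (Real.exp_pos (-(τ - s))).le
        linarith
      have h7 := mul_le_mul_of_nonneg_left (add_le_add h5 h6) (by positivity : 0 ≤ 6 * (n : ℝ))
      have h8 : 0 ≤ π * δ := by positivity
      linarith
    · exact integral_exp_mul_le_of_windows hβc hβ0 hpq hwin (hpa.trans hτ.1) hτ.2 hbq
    · exact integral_exp_mul_le_of_windows_left hβc hβ0 hpq hwin hpa hτ.1 (hτ.2.trans hbq)
  refine le_of_forall_pos_le_add fun ε hε => ?_
  have := hδ (ε / (24 * π)) (by positivity)
  have h1 : π * (ε / (24 * π)) = ε / 24 := by field_simp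
  rw [h1] at this
  linarith

lemma integral_norm_pd2_le (hf : ContDiff ℝ (⊤ : ℕ∞) f) (t : ℝ) :
    ∫ θ in (0 : ℝ)..2 * π, ‖pd2 f (t, θ)‖ ≤ √(2 * π * sliceEnergy f t) := by
  have c2 := hf.pd2.continuous
  have h := sq_integral_mul_le (p := fun θ => ‖pd2 f (t, θ)‖) (q := fun _ => 1)
    (by fun_prop) (by fun_prop) Real.two_pi_pos.le (by simp [Real.pi_pos])
  simp only [mul_one, one_pow, intervalIntegral.integral_const, sub_zero, smul_eq_mul] at h
  refine Real.le_sqrt_of_sq_le (h.trans_eq ?_)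
  rw [sliceEnergy]; ring

lemma norm_sub_le_integral {g g' : ℝ → EuclideanSpace ℝ (Fin n)}
    (hd : ∀ x, HasDerivAt g (g' x) x) (hc : Continuous g') {a b x y : ℝ}
    (hx : x ∈ Icc a b) (hy : y ∈ Icc a b) :
    ‖g x - g y‖ ≤ ∫ s in a..b, ‖g' s‖ := by
  have key : ∀ x ∈ Icc a b, ∀ y ∈ Icc a b, x ≤ y → ‖g x - g y‖ ≤ ∫ s in a..b, ‖g' s‖ := by
    intro x hx y hy hxy
    rw [norm_sub_rev, ← intervalIntegral.integral_eq_sub_of_hasDerivAt (fun s _ => hd s)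
      (hc.intervalIntegrable x y)]
    refine (intervalIntegral.norm_integral_le_integral_norm hxy).trans ?_
    exact intervalIntegral.integral_mono_interval hx.1 hxy hy.2
      (Eventually.of_forall fun s => norm_nonneg _) (hc.norm.intervalIntegrable _ _)
  rcases le_total x y with h | h
  · exact key x hx y hy h
  · rw [norm_sub_rev]; exact key y hy x hx h

lemma oscillation_le (hf : ContDiff ℝ (⊤ : ℕ∞) f) (hconf : ∀ z, ‖pd1 f z‖ ^ 2 = ‖pd2 f z‖ ^ 2)
    {t₁ t₂ θ₁ θ₂ : ℝ} (ht : t₁ ≤ t₂) (hθ₁ : θ₁ ∈ Icc 0 (2 * π)) (hθ₂ : θ₂ ∈ Icc 0 (2 * π)) :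
    2 * π * ‖f (t₁, θ₁) - f (t₂, θ₂)‖ ≤ 2 * π * (√(2 * π * sliceEnergy f t₁)
      + √(2 * π * sliceEnergy f t₂)) + ∫ s in t₁..t₂, √(2 * π * sliceEnergy f s) := by
  have c1 := hf.pd1.continuous
  have c2 := hf.pd2.continuous
  have hEc := continuous_sliceEnergy hf
  have hpt : ∀ θ ∈ Icc 0 (2 * π), ‖f (t₁, θ₁) - f (t₂, θ₂)‖ ≤ √(2 * π * sliceEnergy f t₁)
      + √(2 * π * sliceEnergy f t₂) + ∫ s in t₁..t₂, ‖pd1 f (s, θ)‖ := by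
    intro θ hθ
    have h1 := (norm_sub_le_integral (hf.hasDerivAt_pd2 t₁) (by fun_prop) hθ₁ hθ).trans
      (integral_norm_pd2_le hf t₁)
    have h2 := (norm_sub_le_integral (hf.hasDerivAt_pd2 t₂) (by fun_prop) hθ hθ₂).trans
      (integral_norm_pd2_le hf t₂)
    have h3 := norm_sub_le_integral (fun s => hf.hasDerivAt_pd1 s θ) (by fun_prop)
      (left_mem_Icc.2 ht) (right_mem_Icc.2 ht)
    have h4 := norm_sub_le_norm_sub_add_norm_sub (f (t₁, θ₁)) (f (t₁, θ)) (f (t₂, θ₂))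
    have h5 := norm_sub_le_norm_sub_add_norm_sub (f (t₁, θ)) (f (t₂, θ)) (f (t₂, θ₂))
    linarith
  have hci : Continuous fun θ => ∫ s in t₁..t₂, ‖pd1 f (s, θ)‖ :=
    continuous_slice_integral (F := fun z => ‖pd1 f (z.2, z.1)‖) (by fun_prop) _ _
  have hint := intervalIntegral.integral_mono_on (μ := volume)
    (f := fun _ => ‖f (t₁, θ₁) - f (t₂, θ₂)‖) Real.two_pi_pos.le
    (continuous_const.intervalIntegrable _ _)
    (Continuous.intervalIntegrable (by fun_prop) _ _) hpt
  rw [intervalIntegral.integral_add (continuous_const.intervalIntegrable _ _)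
    (hci.intervalIntegrable _ _), intervalIntegral.integral_const, intervalIntegral.integral_const,
    sub_zero, smul_eq_mul, smul_eq_mul] at hint
  have hswap : ∫ θ in (0 : ℝ)..2 * π, ∫ s in t₁..t₂, ‖pd1 f (s, θ)‖
      = ∫ s in t₁..t₂, ∫ θ in (0 : ℝ)..2 * π, ‖pd1 f (s, θ)‖ := by
    rw [← integral_prod_Icc (F := fun z => ‖pd1 f z‖) (by fun_prop) ht Real.two_pi_pos.le,
      ← integral_prod_Icc (F := fun z => ‖pd1 f (z.2, z.1)‖) (by fun_prop) Real.two_pi_pos.le ht]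
    exact setIntegral_prod_swap (μ := volume) (ν := volume) (Icc t₁ t₂) (Icc (0 : ℝ) (2 * π))
      fun z => ‖pd1 f z‖
  have hlast : ∫ s in t₁..t₂, ∫ θ in (0 : ℝ)..2 * π, ‖pd1 f (s, θ)‖
      ≤ ∫ s in t₁..t₂, √(2 * π * sliceEnergy f s) := by
    have hcs : Continuous fun s => ∫ θ in (0 : ℝ)..2 * π, ‖pd1 f (s, θ)‖ :=
      continuous_slice_integral (F := fun z => ‖pd1 f z‖) (by fun_prop) _ _
    refine intervalIntegral.integral_mono_on ht (hcs.intervalIntegrable _ _)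
      (Continuous.intervalIntegrable (by fun_prop) _ _) fun s _ => ?_
    refine le_trans (le_of_eq ?_) (integral_norm_pd2_le hf s)
    refine intervalIntegral.integral_congr fun θ _ => ?_
    exact (sq_eq_sq₀ (norm_nonneg _) (norm_nonneg _)).1 (hconf _)
  linarith

lemma integral_exp_neg_quarter_le (t₁ t₂ a b : ℝ) (ha : a ≤ t₁) (hb : t₂ ≤ b) :
    ∫ s in t₁..t₂, (Real.exp (-(b - s) / 4) + Real.exp (-(s - a) / 4)) ≤ 8 := by
  have hd : ∀ s ∈ uIcc t₁ t₂, HasDerivAt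
      (fun s => 4 * Real.exp (-(b - s) / 4) - 4 * Real.exp (-(s - a) / 4))
      (Real.exp (-(b - s) / 4) + Real.exp (-(s - a) / 4)) s := by
    intro s _
    have h1 : HasDerivAt (fun s : ℝ => -(b - s) / 4) (1 / 4) s := by
      simpa using (((hasDerivAt_id s).const_sub b).neg).div_const 4
    have h2 : HasDerivAt (fun s : ℝ => -(s - a) / 4) (-1 / 4) s := by
      simpa using (((hasDerivAt_id s).sub_const a).neg).div_const 4
    exact ((h1.exp.const_mul 4).sub (h2.exp.const_mul 4)).congr_deriv (by ring)
  rw [intervalIntegral.integral_eq_sub_of_hasDerivAt hd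
    (Continuous.intervalIntegrable (by fun_prop) _ _)]
  have h1 : Real.exp (-(b - t₂) / 4) ≤ 1 := Real.exp_le_one_iff.2 (by linarith)
  have h2 : Real.exp (-(t₁ - a) / 4) ≤ 1 := Real.exp_le_one_iff.2 (by linarith)
  have h3 := Real.exp_pos (-(b - t₁) / 4)
  have h4 := Real.exp_pos (-(t₂ - a) / 4)
  linarith

lemma integral_gradSq (hf : ContDiff ℝ (⊤ : ℕ∞) f) (hconf : ∀ z, ‖pd1 f z‖ ^ 2 = ‖pd2 f z‖ ^ 2)
    {a b : ℝ} (hab : a ≤ b) :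
    ∫ z in Icc a b ×ˢ Icc 0 (2 * π), gradSq f z = 2 * ∫ s in a..b, sliceEnergy f s := by
  rw [integral_prod_Icc (continuous_gradSq hf) hab Real.two_pi_pos.le,
    ← intervalIntegral.integral_const_mul]
  refine intervalIntegral.integral_congr fun s _ => ?_
  simp only [sliceEnergy]
  rw [← intervalIntegral.integral_const_mul]
  refine intervalIntegral.integral_congr fun θ _ => ?_
  simp only [gradSq, hconf]
  ring

lemma exists_sliceEnergy_le (hf : ContDiff ℝ (⊤ : ℕ∞) f) {p q r : ℝ} (hpr : p ≤ r)
    (hrq : r + 1 ≤ q) : ∃ a ∈ Icc r (r + 1), sliceEnergy f a ≤ ∫ s in p..q, sliceEnergy f s := by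
  obtain ⟨a, ha, hle⟩ := exists_le_integral_unit (continuous_sliceEnergy hf) r
  refine ⟨a, ha, hle.trans ?_⟩
  exact intervalIntegral.integral_mono_interval hpr (by linarith) hrq
    (Eventually.of_forall fun s => sliceEnergy_nonneg f s)
    ((continuous_sliceEnergy hf).intervalIntegrable _ _)

/-- Exponential decay of the slice energy away from both ends bounds the oscillation. -/
lemma oscillation_le_of_decay (hf : ContDiff ℝ (⊤ : ℕ∞) f)
    (hconf : ∀ z, ‖pd1 f z‖ ^ 2 = ‖pd2 f z‖ ^ 2) {a b L : ℝ}
    (hdecay : ∀ t ∈ Icc a b, sliceEnergy f t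
      ≤ 24 * (Real.exp (-(b - t) / 2) * L + Real.exp (-(t - a) / 2) * L))
    {t₁ t₂ θ₁ θ₂ : ℝ} (ha : a ≤ t₁) (ht : t₁ ≤ t₂) (hb : t₂ ≤ b) (hL : 0 ≤ L)
    (hθ₁ : θ₁ ∈ Icc 0 (2 * π)) (hθ₂ : θ₂ ∈ Icc 0 (2 * π)) :
    ‖f (t₁, θ₁) - f (t₂, θ₂)‖ ≤ 6 * √(48 * π * L) := by
  have hκ := Real.sqrt_nonneg (48 * π * L)
  have hκ2 : √(48 * π * L) ^ 2 = 48 * π * L := Real.sq_sqrt (by positivity)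
  set κ := √(48 * π * L)
  have hsq : ∀ x : ℝ, Real.exp (x / 2) = Real.exp (x / 4) ^ 2 := fun x => by
    rw [← Real.exp_nat_mul]; congr 1; push_cast; ring
  have hslice : ∀ t ∈ Icc a b, √(2 * π * sliceEnergy f t)
      ≤ κ * (Real.exp (-(b - t) / 4) + Real.exp (-(t - a) / 4)) := by
    intro t htab
    refine Real.sqrt_le_iff.2 ⟨by positivity, ?_⟩
    have h := mul_le_mul_of_nonneg_left (hdecay t htab) Real.two_pi_pos.le
    rw [hsq, hsq] at h
    have hx : 0 ≤ 48 * π * L * (2 * (Real.exp (-(b - t) / 4) * Real.exp (-(t - a) / 4))) := by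
      positivity
    rw [mul_pow, hκ2]
    linarith
  have hend : ∀ t ∈ Icc a b, √(2 * π * sliceEnergy f t) ≤ 2 * κ := by
    intro t htab
    have h1 : Real.exp (-(b - t) / 4) ≤ 1 := Real.exp_le_one_iff.2 (by linarith [htab.2])
    have h2 : Real.exp (-(t - a) / 4) ≤ 1 := Real.exp_le_one_iff.2 (by linarith [htab.1])
    nlinarith [hslice t htab]
  have hint : ∫ s in t₁..t₂, √(2 * π * sliceEnergy f s) ≤ κ * 8 := by
    have hc := continuous_sliceEnergy hf
    refine (intervalIntegral.integral_mono_on ht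
      (Continuous.intervalIntegrable (by fun_prop) _ _)
      (Continuous.intervalIntegrable (by fun_prop) _ _)
      fun s hs => hslice s ⟨ha.trans hs.1, hs.2.trans hb⟩).trans ?_
    rw [intervalIntegral.integral_const_mul]
    exact mul_le_mul_of_nonneg_left (integral_exp_neg_quarter_le t₁ t₂ a b ha hb) hκ
  have hosc := oscillation_le hf hconf ht hθ₁ hθ₂
  have h1 := hend t₁ ⟨ha, ht.trans hb⟩
  have h2 := hend t₂ ⟨ha.trans ht, hb⟩
  have hpi := Real.pi_gt_three
  refine le_of_mul_le_mul_left (a := 2 * π) ?_ Real.two_pi_pos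
  nlinarith

end Surface

/-- No-neck oscillation estimate (from the proof of Proposition 2.6). -/
theorem no_neck_oscillation (n : ℕ) (hn : 1 ≤ n) :
    ∃ ε₂ > (0:ℝ), ∃ C > (0:ℝ),
      ∀ T : ℝ, 3 ≤ T →
        ∀ f : ℝ × ℝ → EuclideanSpace ℝ (Fin n),
          ContDiff ℝ (⊤ : ℕ∞) f →
          (∀ t θ : ℝ, f (t, θ + 2 * π) = f (t, θ)) →
          (∀ z, ‖pd1 f z‖ ^ 2 = ‖pd2 f z‖ ^ 2 ∧ ⟪pd1 f z, pd2 f z⟫ = 0) →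
          (∀ z, fderiv ℝ f z = 0 → lap f z = 0) →
          (∀ s ∈ Icc (-T) (T - 1),
              willmore f (Icc s (s + 1) ×ˢ Icc 0 (2 * π)) < ENNReal.ofReal (ε₂ ^ 2)) →
          ∀ t₁ θ₁ t₂ θ₂ : ℝ, t₁ ∈ Icc (-T + 2) (T - 2) → t₂ ∈ Icc (-T + 2) (T - 2) →
            ‖f (t₁, θ₁) - f (t₂, θ₂)‖ ≤
              C * Real.sqrt (∫ z in Icc (-T) T ×ˢ Icc 0 (2 * π), gradSq f z) := by
  refine ⟨1 / (12 * n), by positivity, 6 * √(24 * π), by positivity, ?_⟩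
  intro T hT f hf hper hconf hlap hW
  have hconf1 : ∀ z, ‖pd1 f z‖ ^ 2 = ‖pd2 f z‖ ^ 2 := fun z => (hconf z).1
  obtain ⟨a, ha, hEa⟩ := exists_sliceEnergy_le hf (p := -T) (q := T) (r := -T) le_rfl (by linarith)
  obtain ⟨b, hb, hEb⟩ := exists_sliceEnergy_le hf (p := -T) (q := T) (r := T - 1) (by linarith)
    (by linarith)
  have hL : 0 ≤ ∫ s in -T..T, sliceEnergy f s :=
    intervalIntegral.integral_nonneg (by linarith) fun s _ => sliceEnergy_nonneg f s
  rw [integral_gradSq hf hconf1 (by linarith : -T ≤ T)]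
  set L := ∫ s in -T..T, sliceEnergy f s
  have hdecay : ∀ t ∈ Icc a b, sliceEnergy f t
      ≤ 24 * (Real.exp (-(b - t) / 2) * L + Real.exp (-(t - a) / 2) * L) := by
    intro t ht
    refine (sliceEnergy_decay hn hf hper hconf1 hlap (by linarith : -T + 1 ≤ T) hW ha.1
      (by linarith [hb.2]) ht.1 ht.2).trans ?_
    gcongr
  have hord : ∀ t₁ θ₁ t₂ θ₂ : ℝ, t₁ ∈ Icc (-T + 2) (T - 2) → t₂ ∈ Icc (-T + 2) (T - 2) →
      t₁ ≤ t₂ → ‖f (t₁, θ₁) - f (t₂, θ₂)‖ ≤ 6 * √(48 * π * L) := by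
    intro t₁ θ₁ t₂ θ₂ h₁ h₂ h₁₂
    obtain ⟨x, hx, hfx⟩ := Function.Periodic.exists_mem_Ico₀
      (f := fun θ => f (t₁, θ)) (fun θ => hper t₁ θ) Real.two_pi_pos θ₁
    obtain ⟨y, hy, hfy⟩ := Function.Periodic.exists_mem_Ico₀
      (f := fun θ => f (t₂, θ)) (fun θ => hper t₂ θ) Real.two_pi_pos θ₂
    rw [hfx, hfy]
    exact oscillation_le_of_decay hf hconf1 hdecay (by linarith [ha.2, h₁.1]) h₁₂
      (by linarith [hb.1, h₂.2]) hL (Ico_subset_Icc_self hx) (Ico_subset_Icc_self hy)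
  have hC : 6 * √(24 * π) * √(2 * L) = 6 * √(48 * π * L) := by
    rw [mul_assoc, ← Real.sqrt_mul (by positivity)]
    ring_nf
  intro t₁ θ₁ t₂ θ₂ h₁ h₂
  rw [hC]
  rcases le_total t₁ t₂ with h | h
  · exact hord t₁ θ₁ t₂ θ₂ h₁ h₂ h
  · rw [norm_sub_rev]
    exact hord t₂ θ₂ t₁ θ₁ h₂ h₁ h
end

section
/- (Decomposition of long cylinders, Lemma 2.7) Fix ε₂ > 0 and Λ > 0. Let T_k → +∞ and let f_k : ℝ² → ℝⁿ be smooth maps, each 2π-periodic in θ, such that sup_k W(f_k, [0,T_k]×[0,2π]) ≤ Λ. Then there exist a subsequence (still denoted f_k), an integer l with l < Λ/ε₂² + 1, and for each k real numbers 0 = d_k^0 < d_k^1 < ⋯ < d_k^l = T_k, such that: (i) for each j ∈ {1,…,l}, d_k^j − d_k^{j−1} → +∞ as k → ∞; (ii) for each j ∈ {1,…,l−1}, W(f_k, [d_k^j, d_k^j + 1]×[0,2π]) ≥ ε₂² for all k; (iii) for each j ∈ {1,…,l}, lim_{T→+∞} liminf_{k→∞} sup_{t ∈ [d_k^{j−1}+T,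 d_k^j − T]} W(f_k, [t,t+1]×[0,2π]) ≤ ε₂². -/
open MeasureTheory Set Filter
open scoped ENNReal Real RealInnerProductSpace

/-- The strip `[t, t + 1] × [0, 2π]` of the cylinder. -/
def cylinderStrip (t : ℝ) : Set (ℝ × ℝ) := Icc t (t + 1) ×ˢ Icc 0 (2 * π)

lemma measurableSet_cylinderStrip (t : ℝ) : MeasurableSet (cylinderStrip t) :=
  measurableSet_Icc.prod measurableSet_Icc

lemma willmore_mono {n : ℕ} (f : ℝ × ℝ → EuclideanSpace ℝ (Fin n)) {A B : Set (ℝ × ℝ)}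
    (h : A ⊆ B) : willmore f A ≤ willmore f B :=
  lintegral_mono_set (inter_subset_inter_left _ h)

lemma willmore_biUnion_finset {n : ℕ} (f : ℝ × ℝ → EuclideanSpace ℝ (Fin n)) {ι : Type*}
    (s : Finset ι) (A : ι → Set (ℝ × ℝ)) (hA : ∀ i ∈ s, MeasurableSet (A i))
    (hd : (s : Set ι).PairwiseDisjoint A) :
    willmore f (⋃ i ∈ s, A i) = ∑ i ∈ s, willmore f (A i) := by
  have key : ∀ B : Set (ℝ × ℝ), MeasurableSet B → willmore f B =
      ∫⁻ z in B, ENNReal.ofReal (‖lap f z‖ ^ 2 / gradSq f z)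
        ∂(volume.restrict {w | gradSq f w ≠ 0}) := fun B hB => by
    rw [willmore, Measure.restrict_restrict hB]
  rw [key _ (s.measurableSet_biUnion hA), lintegral_biUnion_finset hd hA]
  exact Finset.sum_congr rfl fun i hi => (key _ (hA i hi)).symm

/-- A cylinder of energy at most `Λ` contains fewer than `Λ / c` unit strips, at pairwise
distance larger than one, of energy larger than `c`. -/
lemma natCast_lt_of_lt_willmore_cylinderStrip {n l : ℕ} {c Λ : ℝ} (hc : 0 < c) (hΛ : 0 < Λ)
    {f : ℝ × ℝ → EuclideanSpace ℝ (Fin n)} {d : ℕ → ℝ} {T : ℝ} (h0 : d 0 = 0) (hl : d l = T)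
    (hgap : ∀ j < l, d j + 1 < d (j + 1))
    (hW : willmore f (Icc 0 T ×ˢ Icc 0 (2 * π)) ≤ ENNReal.ofReal Λ)
    (hd : ∀ j, 0 < j → j < l → ENNReal.ofReal c < willmore f (cylinderStrip (d j))) :
    (l : ℝ) < Λ / c + 1 := by
  have hmono : ∀ i j, i < j → j ≤ l → d i + 1 < d j := by
    intro i j hij
    induction j, hij using Nat.le_induction with
    | base => exact fun h => hgap i h
    | succ j hij ih => intro h; linarith [ih (by omega), hgap j h]
  have hpos : 0 < Λ / c := div_pos hΛ hc
  rcases Nat.lt_or_ge 1 l with h1 | h1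
  swap
  · have : (l : ℝ) ≤ 1 := by exact_mod_cast h1
    linarith
  have hlt : ∀ i j, i < j → j < l → Disjoint (cylinderStrip (d i)) (cylinderStrip (d j)) := by
    intro i j hij hjl
    rw [Set.disjoint_left]
    rintro ⟨x, y⟩ hx hy
    have := hmono i j hij hjl.le
    have h2 : x ≤ d i + 1 := hx.1.2
    have h3 : d j ≤ x := hy.1.1
    linarith
  have hdisj : ((Finset.Ico 1 l : Finset ℕ) : Set ℕ).PairwiseDisjoint
      fun j => cylinderStrip (d j) := by
    intro i hi j hj hij
    simp only [Finset.coe_Ico, Set.mem_Ico] at hi hj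
    rcases lt_or_gt_of_ne hij with h | h
    · exact hlt i j h hj.2
    · exact (hlt j i h hi.2).symm
  have hsub : (⋃ j ∈ Finset.Ico 1 l, cylinderStrip (d j)) ⊆ Icc 0 T ×ˢ Icc 0 (2 * π) := by
    refine iUnion₂_subset fun j hj => prod_mono_left (Icc_subset_Icc ?_ ?_)
    · rw [Finset.mem_Ico] at hj
      linarith [hmono 0 j (by omega) (by omega)]
    · rw [Finset.mem_Ico] at hj
      linarith [hmono j l (by omega) le_rfl]
  have hsum : ∑ j ∈ Finset.Ico 1 l, willmore f (cylinderStrip (d j)) ≤ ENNReal.ofReal Λ := by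
    rw [← willmore_biUnion_finset f _ _ (fun _ _ => measurableSet_cylinderStrip _) hdisj]
    exact (willmore_mono f hsub).trans hW
  have hstrict : ∑ _j ∈ Finset.Ico 1 l, ENNReal.ofReal c <
      ∑ j ∈ Finset.Ico 1 l, willmore f (cylinderStrip (d j)) := by
    refine ENNReal.sum_lt_sum_of_nonempty (Finset.nonempty_Ico.2 h1) fun j hj => ?_
    rw [Finset.mem_Ico] at hj
    exact hd j hj.1 hj.2
  have hfin := hstrict.trans_le hsum
  rw [← ENNReal.ofReal_sum_of_nonneg fun _ _ => hc.le, ENNReal.ofReal_lt_ofReal_iff hΛ] at hfin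
  simp only [Finset.sum_const, Nat.card_Ico, nsmul_eq_mul, Nat.cast_sub h1.le,
    Nat.cast_one] at hfin
  rw [← sub_lt_iff_lt_add, lt_div_iff₀ hc]
  exact hfin

/-- Division points `0 = d₀ < ⋯ < d_l = T` of the cylinders along a subsequence `φ` which drift
apart, with energy larger than `c` concentrated at the interior ones. -/
structure IsCylinderDivision {n : ℕ} (c : ℝ) (T : ℕ → ℝ)
    (f : ℕ → ℝ × ℝ → EuclideanSpace ℝ (Fin n)) (l : ℕ) (φ : ℕ → ℕ) (d : ℕ → ℕ → ℝ) : Prop where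
  strictMono : StrictMono φ
  start : ∀ k, d k 0 = 0
  finish : ∀ k, d k l = T (φ k)
  gap : ∀ k, ∀ j < l, d k j + 1 < d k (j + 1)
  tendsto : ∀ j < l, Tendsto (fun k => d k (j + 1) - d k j) atTop atTop
  energy : ∀ j, 0 < j → j < l → ∀ k,
    ENNReal.ofReal c < willmore (f (φ k)) (cylinderStrip (d k j))

lemma exists_isCylinderDivision_one {n : ℕ} (c : ℝ) {T : ℕ → ℝ} (hT : Tendsto T atTop atTop)
    (f : ℕ → ℝ × ℝ → EuclideanSpace ℝ (Fin n)) :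
    ∃ φ d, IsCylinderDivision c T f 1 φ d := by
  obtain ⟨φ, hφ, h⟩ := extraction_of_eventually_atTop (hT.eventually_gt_atTop 1)
  refine ⟨φ, fun k j => if j = 0 then 0 else T (φ k), hφ, ?_, ?_, ?_, ?_, ?_⟩
  · simp
  · simp
  · intro k j hj
    obtain rfl : j = 0 := by omega
    simpa using h k
  · intro j hj
    obtain rfl : j = 0 := by omega
    simpa [Function.comp_def] using hT.comp hφ.tendsto_atTop
  · intro j h0 h1
    omega

/-- If energy larger than `c` concentrates inside some piece of a division, away from its ends,
then the division can be refined after passing to a further subsequence. -/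
lemma IsCylinderDivision.exists_succ {n l : ℕ} {c : ℝ} {T : ℕ → ℝ}
    {f : ℕ → ℝ × ℝ → EuclideanSpace ℝ (Fin n)} {φ : ℕ → ℕ} {d : ℕ → ℕ → ℝ}
    (h : IsCylinderDivision c T f l φ d) {j : ℕ} (hj : j < l)
    (hlt : ENNReal.ofReal c < limsup (fun T' : ℝ => liminf (fun k =>
      ⨆ t ∈ Icc (d k j + T') (d k (j + 1) - T'), willmore (f (φ k)) (cylinderStrip t))
        atTop) atTop) :
    ∃ φ' d', IsCylinderDivision c T f (l + 1) φ' d' := by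
  have hev : ∀ m : ℕ, ∀ᶠ k in atTop, ∃ t ∈ Icc (d k j + (m + 2)) (d k (j + 1) - (m + 2)),
      ENNReal.ofReal c < willmore (f (φ k)) (cylinderStrip t) := by
    intro m
    obtain ⟨T', hT', hlt'⟩ :=
      (frequently_lt_of_lt_limsup (by isBoundedDefault) hlt).forall_exists_of_atTop ((m : ℝ) + 2)
    filter_upwards [eventually_lt_of_lt_liminf hlt'] with k hk
    simp only [lt_iSup_iff] at hk
    obtain ⟨t, ht, hk⟩ := hk
    exact ⟨t, ⟨by linarith [ht.1], by linarith [ht.2]⟩, hk⟩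
  obtain ⟨ψ, hψ, H⟩ := extraction_forall_of_eventually hev
  choose t ht hWt using H
  let d' : ℕ → ℕ → ℝ := fun k i =>
    if i ≤ j then d (ψ k) i else if i = j + 1 then t k else d (ψ k) (i - 1)
  have hle : ∀ k i, i ≤ j → d' k i = d (ψ k) i := fun k i hi => if_pos hi
  have heq : ∀ k, d' k (j + 1) = t k := fun k => by simp [d']
  have hgt : ∀ k i, j < i → d' k (i + 1) = d (ψ k) i := fun k i hi => by
    simp only [d']
    rw [if_neg (by omega), if_neg (by omega), Nat.add_sub_cancel]
  have hm : Tendsto (fun k : ℕ => (k : ℝ)) atTop atTop := tendsto_natCast_atTop_atTop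
  have hcases : ∀ i < l + 1, i < j ∨ i = j ∨ i = j + 1 ∨ ∃ i', i = i' + 1 ∧ j < i' ∧ i' < l := by
    intro i hi
    rcases lt_trichotomy i j with h | h | h
    · exact .inl h
    · exact .inr (.inl h)
    · rcases Nat.eq_or_lt_of_le h with h | h
      · exact .inr (.inr (.inl h.symm))
      · exact .inr (.inr (.inr ⟨i - 1, by omega, by omega, by omega⟩))
  refine ⟨φ ∘ ψ, d', h.strictMono.comp hψ, fun k => ?_, fun k => ?_, fun k i hi => ?_,
    fun i hi => ?_, fun i h0 hi k => ?_⟩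
  · rw [hle k 0 (Nat.zero_le _), h.start]
  · rw [hgt k l hj, h.finish, Function.comp_apply]
  · have hk : (0 : ℝ) ≤ k := k.cast_nonneg
    rcases hcases i hi with h1 | rfl | rfl | ⟨i, rfl, h1, h2⟩
    · rw [hle k i h1.le, hle k (i + 1) h1]
      exact h.gap _ _ (by omega)
    · rw [hle k i le_rfl, heq]
      linarith [(ht k).1]
    · rw [heq, hgt k (j + 1) (by omega)]
      linarith [(ht k).2]
    · rw [hgt k i h1, hgt k (i + 1) (by omega)]
      exact h.gap _ _ h2
  · rcases hcases i hi with h1 | rfl | rfl | ⟨i, rfl, h1, h2⟩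
    · simp only [hle _ i h1.le, hle _ (i + 1) h1]
      exact (h.tendsto i (by omega)).comp hψ.tendsto_atTop
    · simp only [hle _ i le_rfl, heq]
      exact tendsto_atTop_mono (fun k => by linarith [(ht k).1]) hm
    · simp only [heq, hgt _ (j + 1) (Nat.lt_succ_self j)]
      exact tendsto_atTop_mono (fun k => by linarith [(ht k).2]) hm
    · simp only [hgt _ i h1, hgt _ (i + 1) (Nat.lt_succ_of_lt h1)]
      exact (h.tendsto i h2).comp hψ.tendsto_atTop
  · rcases hcases i hi with h1 | rfl | rfl | ⟨i, rfl, h1, h2⟩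
    · rw [hle k i h1.le]
      exact h.energy i h0 (by omega) _
    · rw [hle k i le_rfl]
      exact h.energy i h0 hj _
    · rw [heq]
      exact hWt k
    · rw [hgt k i h1]
      exact h.energy i (by omega) h2 _

/-- Decomposition of long cylinders (Lemma 2.7). -/
theorem long_cylinder_decomposition (n : ℕ) (ε₂ Λ : ℝ) (hε₂ : 0 < ε₂) (hΛ : 0 < Λ)
    (T : ℕ → ℝ) (hT : Tendsto T atTop atTop)
    (f : ℕ → ℝ × ℝ → EuclideanSpace ℝ (Fin n))
    (hsm : ∀ k, ContDiff ℝ (⊤ : ℕ∞) (f k))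
    (hper : ∀ k, ∀ t θ : ℝ, f k (t, θ + 2 * π) = f k (t, θ))
    (hW : ∀ k, willmore (f k) (Icc 0 (T k) ×ˢ Icc 0 (2 * π)) ≤ ENNReal.ofReal Λ) :
    ∃ φ : ℕ → ℕ, StrictMono φ ∧
    ∃ l : ℕ, (l : ℝ) < Λ / ε₂ ^ 2 + 1 ∧
    ∃ d : ℕ → ℕ → ℝ,
      (∀ k, d k 0 = 0) ∧
      (∀ k, d k l = T (φ k)) ∧
      (∀ k, ∀ j < l, d k j < d k (j + 1)) ∧
      -- (i) consecutive division points drift apart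
      (∀ j < l, Tendsto (fun k => d k (j + 1) - d k j) atTop atTop) ∧
      -- (ii) concentration at the interior division points
      (∀ j, 0 < j → j < l → ∀ k,
          ENNReal.ofReal (ε₂ ^ 2) ≤
            willmore (f (φ k)) (Icc (d k j) (d k j + 1) ×ˢ Icc 0 (2 * π))) ∧
      -- (iii) no concentration in the middle of each piece
      (∀ j < l,
          Filter.limsup (fun T' : ℝ =>
              Filter.liminf (fun k =>
                  ⨆ t ∈ Icc (d k j + T') (d k (j + 1) - T'),
                    willmore (f (φ k)) (Icc t (t + 1) ×ˢ Icc 0 (2 * π))) atTop) atTop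
            ≤ ENNReal.ofReal (ε₂ ^ 2)) := by
  by_contra hcon
  have hc : 0 < ε₂ ^ 2 := by positivity
  have hbound : ∀ l φ d, IsCylinderDivision (ε₂ ^ 2) T f l φ d → (l : ℝ) < Λ / ε₂ ^ 2 + 1 :=
    fun l φ d h => natCast_lt_of_lt_willmore_cylinderStrip hc hΛ (h.start 0) (h.finish 0)
      (h.gap 0) (hW _) fun j h0 h1 => h.energy j h0 h1 0
  have hall : ∀ l : ℕ, ∃ φ d, IsCylinderDivision (ε₂ ^ 2) T f (l + 1) φ d := by
    intro l
    induction l with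
    | zero => exact exists_isCylinderDivision_one _ hT f
    | succ l ih =>
      obtain ⟨φ, d, h⟩ := ih
      by_contra hno
      refine hcon ⟨φ, h.strictMono, l + 1, hbound _ _ _ h, d, h.start, h.finish,
        fun k j hj => by linarith [h.gap k j hj], h.tendsto,
        fun j h0 h1 k => (h.energy j h0 h1 k).le, fun j hj => ?_⟩
      by_contra hlt
      exact hno (h.exists_succ hj (not_le.1 hlt))
  obtain ⟨N, hN⟩ := exists_nat_gt (Λ / ε₂ ^ 2 + 1)
  obtain ⟨φ, d, h⟩ := hall N
  have := hbound _ _ _ h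
  push_cast at this
  linarith
end

section
/- (Exponential decay from a delayed differential inequality, from the proof of Proposition 2.3) There exists a universal constant C > 0 (one may take C = 4e²) such that the following holds. Let T ≥ 2 and ε' > 0 with ε₂ := ε'e² < 1. Let φ : [−T, T] → [0, ∞) be a C¹, nondecreasing function satisfying φ(t) ≤ φ'(t) + ε' φ(t+2) for all t ∈ [−T, T−2]. Then for every t ∈ [−T, T−2], φ(t) ≤ C φ(T) e^{−(1−ε₂)(T−t)}. -/
open Set

/-- The exponential `A * exp (-(1 - ε * exp 2) * (T - t))` is a supersolution of the delayed
equation `ψ = ψ' + ε * ψ (· + 2)`. -/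
lemma exp_supersolution {A ε : ℝ} (T s : ℝ) (hA : 0 ≤ A) (hε : 0 < ε) :
    (1 - ε * Real.exp 2) * (A * Real.exp (-(1 - ε * Real.exp 2) * (T - s))) +
      ε * (A * Real.exp (-(1 - ε * Real.exp 2) * (T - (s + 2)))) ≤
      A * Real.exp (-(1 - ε * Real.exp 2) * (T - s)) := by
  set l := 1 - ε * Real.exp 2 with hl
  have hl1 : l ≤ 1 := by
    have := mul_pos hε (Real.exp_pos 2)
    linarith
  have hshift : Real.exp (-l * (T - (s + 2))) ≤ Real.exp 2 * Real.exp (-l * (T - s)) := by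
    rw [← Real.exp_add]
    exact Real.exp_le_exp.2 (by linarith)
  have := mul_le_mul_of_nonneg_left hshift (mul_nonneg hε.le hA)
  have he : ε * Real.exp 2 = 1 - l := by rw [hl]; ring
  linear_combination this + (A * Real.exp (-l * (T - s))) * he

/-- If `w' ≤ w` on the interior of `[a, b]` and `0 ≤ w b`, then `0 ≤ w a`. -/
lemma nonneg_left_of_hasDerivAt_le_self {w w' : ℝ → ℝ} {a b : ℝ} (hab : a ≤ b)
    (hc : ContinuousOn w (Icc a b)) (hd : ∀ s ∈ Ioo a b, HasDerivAt w (w' s) s)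
    (hle : ∀ s ∈ Ioo a b, w' s ≤ w s) (hb : 0 ≤ w b) : 0 ≤ w a := by
  have hanti : AntitoneOn (fun s => Real.exp (-s) * w s) (Icc a b) := by
    refine antitoneOn_of_hasDerivWithinAt_nonpos (convex_Icc a b) (by fun_prop)
      (f' := fun s => Real.exp (-s) * (-1) * w s + Real.exp (-s) * w' s) ?_ ?_
    · intro s hs
      rw [interior_Icc] at hs
      exact (((hasDerivAt_neg s).exp).mul (hd s hs)).hasDerivWithinAt
    · intro s hs
      rw [interior_Icc] at hs
      have := mul_le_mul_of_nonneg_left (hle s hs) (Real.exp_pos (-s)).le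
      linarith
  have h := hanti (left_mem_Icc.2 hab) (right_mem_Icc.2 hab) hab
  exact nonneg_of_mul_nonneg_right ((mul_nonneg (Real.exp_pos _).le hb).trans h)
    (Real.exp_pos _)

/-- Exponential decay from a delayed differential inequality (from the proof of
Proposition 2.3). -/
theorem exponential_decay_delayed_inequality :
    ∃ C > (0:ℝ),
      ∀ T : ℝ, 2 ≤ T →
      ∀ ε' : ℝ, 0 < ε' → ε' * Real.exp 2 < 1 →
      ∀ φ : ℝ → ℝ,
        ContDiffOn ℝ 1 φ (Icc (-T) T) →
        (∀ t ∈ Icc (-T) T, 0 ≤ φ t) →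
        MonotoneOn φ (Icc (-T) T) →
        (∀ t ∈ Icc (-T) (T - 2),
            φ t ≤ derivWithin φ (Icc (-T) T) t + ε' * φ (t + 2)) →
        ∀ t ∈ Icc (-T) (T - 2),
          φ t ≤ C * φ T * Real.exp (-(1 - ε' * Real.exp 2) * (T - t)) := by
  refine ⟨Real.exp 2, Real.exp_pos 2, ?_⟩
  intro T hT ε hε hε1 φ hφ hnonneg hmono hineq
  have hTmem : T ∈ Icc (-T) T := ⟨by linarith, le_rfl⟩
  have hA : 0 ≤ Real.exp 2 * φ T := mul_nonneg (Real.exp_pos 2).le (hnonneg T hTmem)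
  have hl1 : 1 - ε * Real.exp 2 ≤ 1 := by
    have := mul_pos hε (Real.exp_pos 2)
    linarith
  have hsuper := fun s => exp_supersolution T s hA hε
  set l := 1 - ε * Real.exp 2 with hl
  set A := Real.exp 2 * φ T with hAdef
  have key : ∀ n : ℕ, ∀ t ∈ Icc (-T) T, T - 2 * (n + 1) ≤ t →
      0 ≤ A * Real.exp (-l * (T - t)) - φ t := by
    intro n
    induction n with
    | zero =>
      intro t ht htn
      have h1 : φ t ≤ φ T := hmono ht hTmem ht.2
      have h2 : 1 ≤ Real.exp 2 * Real.exp (-l * (T - t)) := by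
        rw [← Real.exp_add]
        apply Real.one_le_exp
        have := mul_le_mul_of_nonneg_right hl1 (sub_nonneg.2 ht.2)
        push_cast at htn
        linarith
      have h3 := mul_le_mul_of_nonneg_left h2 (hnonneg T hTmem)
      rw [hAdef]
      linarith
    | succ n ih =>
      intro t ht htn
      push_cast at htn
      rcases le_total (T - 2 * (n + 1)) t with h | h
      · exact ih t ht h
      have hn : (0 : ℝ) ≤ n := n.cast_nonneg
      have hsub : Icc t (T - 2 * (n + 1)) ⊆ Icc (-T) T :=
        Icc_subset_Icc ht.1 (by linarith)
      refine nonneg_left_of_hasDerivAt_le_self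
        (w := fun s => A * Real.exp (-l * (T - s)) - φ s)
        (w' := fun s => l * (A * Real.exp (-l * (T - s))) - derivWithin φ (Icc (-T) T) s)
        h ?_ ?_ ?_ (ih _ (hsub (right_mem_Icc.2 h)) le_rfl)
      · have := hφ.continuousOn.mono hsub
        fun_prop
      · intro s hs
        have hnhds : Icc (-T) T ∈ nhds s :=
          Icc_mem_nhds (by linarith [hs.1, ht.1]) (by linarith [hs.2])
        have hφs : HasDerivAt φ (derivWithin φ (Icc (-T) T) s) s :=
          ((hφ.differentiableOn one_ne_zero s
            (hsub (Ioo_subset_Icc_self hs))).hasDerivWithinAt).hasDerivAt hnhds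
        have hexp := ((((hasDerivAt_id s).const_sub T).const_mul (-l)).exp).const_mul A
        exact (hexp.congr_deriv (by simp; ring)).sub hφs
      · intro s hs
        have h1 := hineq s ⟨by linarith [hs.1, ht.1], by linarith [hs.2]⟩
        have h2 := ih (s + 2) ⟨by linarith [hs.1, ht.1], by linarith [hs.2]⟩
          (by linarith [hs.1])
        have h3 := mul_nonneg hε.le h2
        have h4 := hsuper s
        linarith
  intro t ht
  obtain ⟨n, hn⟩ := exists_nat_gt T
  have := key n t ⟨ht.1, by linarith [ht.2]⟩ (by linarith [ht.1])
  linarith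
end
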